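/- Let D, D′ ∈ X^n be datasets of equal size n that differ in exactly one coordinate (replace-one adjacency), with batch size k ≤ n and q = k/n < 1. Then for every α > 1 and every integer m ≥ 3, sup over θ ∈ ℝ^p of D_α( p^{FSwoR}(·|θ,D) ‖ p^{FSwoR}(·|θ,D′) ) is at most (1/(α−1))·log[ 1 + q²·α·(α−1)·(e^{4/σ²} − e^{2/σ²}) + Σ_{j=3}^{m−1} (q^j/j!)·F̃_{α,σ,j} + Ẽ_{α,σ,m}(q) ]. -/

import Mathlib

open MeasureTheory Finset

noncomputable section

/-- `p`-dimensional Gaussian density with mean `μ` and covariance `s² I`. -/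
def gaussND {p : ℕ} (μ : EuclideanSpace ℝ (Fin p)) (s : ℝ)
    (x : EuclideanSpace ℝ (Fin p)) : ℝ :=
  (2 * Real.pi * s ^ 2) ^ (-(p : ℝ) / 2) * Real.exp (-‖x - μ‖ ^ 2 / (2 * s ^ 2))

/-- one-dimensional Gaussian density with mean `μ` and variance `s²`. -/
def gauss1 (μ s θ : ℝ) : ℝ :=
  (2 * Real.pi * s ^ 2) ^ (-(1 : ℝ) / 2) * Real.exp (-(θ - μ) ^ 2 / (2 * s ^ 2))

/-- Rényi divergence of order `α` between densities `P` and `Q` w.r.t. the measure `ν`. -/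
def renyiDiv {Ω : Type*} [MeasurableSpace Ω] (ν : Measure Ω) (α : ℝ) (P Q : Ω → ℝ) : ℝ :=
  (α - 1)⁻¹ * Real.log (∫ x, (P x / Q x) ^ α * Q x ∂ν)

/-- `M_{σ,k} = ∫ (N_{1,σ²/4}/N_{0,σ²/4} − 1)^k N_{0,σ²/4}`. -/
def Mcoef (σ : ℝ) (k : ℕ) : ℝ :=
  ∫ θ : ℝ, (gauss1 1 (σ / 2) θ / gauss1 0 (σ / 2) θ - 1) ^ k * gauss1 0 (σ / 2) θ

/-- `B̃_{σ,j}`. -/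
def Btil (σ : ℝ) (j : ℕ) : ℝ :=
  if Even j then Mcoef σ j else Real.sqrt (Mcoef σ (j - 1) * Mcoef σ (j + 1))

/-- `H_{α,σ}(q)`. -/
def Hfun (α σ q : ℝ) : ℝ :=
  ∫ θ : ℝ, (q * (gauss1 1 (σ / 2) θ / gauss1 0 (σ / 2) θ) + (1 - q)) ^ α * gauss1 0 (σ / 2) θ

/-- `R̃_{α,σ,3}(q)`. -/
def Rtil3 (α σ q : ℝ) : ℝ :=
  if 3 < α then
    q ^ 3 * α * (α - 1) * |α - 2| *
      ((∑ ℓ ∈ Finset.range (⌈α⌉₊ - 3 + 1),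
          q ^ ℓ * ((⌈α⌉₊ - 3).factorial : ℝ) /
            (((⌈α⌉₊ - 3 - ℓ).factorial : ℝ) * ((3 + ℓ).factorial : ℝ)) * Btil σ (ℓ + 3)) +
        1 / 6 * Btil σ 3)
  else
    q ^ 3 * α * (α - 1) * |α - 2| * (1 / 6 * (1 - q) ^ (α - 3) * Btil σ 3)

/-- `F̃_{α,σ,k}`. -/
def Ftil (α σ : ℝ) (k : ℕ) : ℝ :=
  (α - 1) * α ^ (k - 1) *
      (if Even k then 4 * Mcoef σ k else 3 * Real.sqrt (Mcoef σ (k - 1) * Mcoef σ (k + 1))) +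
    (α - 1) * α ^ (k - 1) *
      ∑ j ∈ Finset.range (k + 1),
        (k.choose j : ℝ) *
          |α / (α - 1) * (∏ ℓ ∈ Finset.range j, (1 - (ℓ : ℝ) / α)) *
              (∏ ℓ ∈ Finset.range (k - j), (1 + ((ℓ : ℝ) - 1) / α)) - 1| *
          Btil σ k

/-- `Ẽ_{α,σ,m}(q)`. -/
def Etil (α σ : ℝ) (m : ℕ) (q : ℝ) : ℝ :=
  (q ^ m / (m.factorial : ℝ)) *
    ∑ j ∈ Finset.range (m + 1),
      (1 - q) ^ (-(α + (m : ℝ) - (j : ℝ) - 1)) * (m.choose j : ℝ) *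
        (∏ ℓ ∈ Finset.range j, |α - (ℓ : ℝ)|) *
        (∏ ℓ ∈ Finset.range (m - j), (α + (ℓ : ℝ) - 1)) *
        (if α ≤ (j : ℝ) then (1 - q) ^ (α - (j : ℝ)) * Btil σ m
         else Btil σ m + ∑ ℓ ∈ Finset.range (⌈α⌉₊ - j + 1),
           q ^ ℓ * ((⌈α⌉₊ - j).factorial : ℝ) * (m.factorial : ℝ) /
             (((⌈α⌉₊ - j - ℓ).factorial : ℝ) * ((m + ℓ).factorial : ℝ)) * Btil σ (ℓ + m))

/-- clipping to norm at most `C`. -/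
def clip {E : Type*} [NormedAddCommGroup E] [NormedSpace ℝ E] (C : ℝ) (x : E) : E :=
  (max 1 (‖x‖ / C))⁻¹ • x

/-- DP-SGD one-step mean for an index batch `b`. -/
def muStep {X : Type*} {p n : ℕ} (C η : ℝ) (k : ℕ)
    (g : EuclideanSpace ℝ (Fin p) → X → EuclideanSpace ℝ (Fin p))
    (θ : EuclideanSpace ℝ (Fin p)) (b : Finset (Fin n)) (D : Fin n → X) :
    EuclideanSpace ℝ (Fin p) :=
  θ - (η / (k : ℝ)) • ∑ i ∈ b, clip C (g θ (D i))

/-- fixed-size without-replacement DP-SGD transition density. -/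
def pFSwoR {X : Type*} {p : ℕ} (C η σ : ℝ) (k : ℕ)
    (g : EuclideanSpace ℝ (Fin p) → X → EuclideanSpace ℝ (Fin p))
    (n : ℕ) (D : Fin n → X) (θ θ' : EuclideanSpace ℝ (Fin p)) : ℝ :=
  ((n.choose k : ℝ))⁻¹ *
    ∑ b ∈ Finset.powersetCard k (Finset.univ : Finset (Fin n)),
      gaussND (muStep C η k g θ b D) (C * η * σ / (k : ℝ)) θ'

/-- fixed-size with-replacement DP-SGD transition density. -/
def pFSwR {X : Type*} {p : ℕ} (C η σ : ℝ) (k : ℕ)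
    (g : EuclideanSpace ℝ (Fin p) → X → EuclideanSpace ℝ (Fin p))
    (n : ℕ) (D : Fin n → X) (θ θ' : EuclideanSpace ℝ (Fin p)) : ℝ :=
  (((n : ℝ)) ^ k)⁻¹ *
    ∑ b : Fin k → Fin n,
      gaussND (θ - (η / (k : ℝ)) • ∑ j : Fin k, clip C (g θ (D (b j))))
        (C * η * σ / (k : ℝ)) θ'

/-- Poisson-subsampled DP-SGD transition density with sampling probability `k/n`. -/
def pPoisson {X : Type*} {p : ℕ} (C η σ : ℝ) (k : ℕ)
    (g : EuclideanSpace ℝ (Fin p) → X → EuclideanSpace ℝ (Fin p))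
    (n : ℕ) (D : Fin n → X) (θ θ' : EuclideanSpace ℝ (Fin p)) : ℝ :=
  ∑ S : Finset (Fin n),
    ((k : ℝ) / n) ^ S.card * (1 - (k : ℝ) / n) ^ (n - S.card) *
      gaussND (muStep C η k g θ S D) (C * η * σ / (k : ℝ)) θ'

/-- removing the `i`-th entry of a tuple. -/
def removeIdx {X : Type*} {n : ℕ} (i : Fin (n + 1)) (D : Fin (n + 1) → X) : Fin n → X :=
  fun j => D (i.succAbove j)

/-- `D'` is obtained from `D` by removing one element. -/
def IsRemoveOne {X : Type*} {m n : ℕ} (D : Fin m → X) (D' : Fin n → X) : Prop :=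
  ∃ (h : n + 1 = m) (i : Fin (n + 1)), D' = removeIdx i (fun j => D (Fin.cast h j))

/-- add/remove adjacency. -/
def AdjAddRemove {X : Type*} {m n : ℕ} (D : Fin m → X) (D' : Fin n → X) : Prop :=
  IsRemoveOne D D' ∨ IsRemoveOne D' D

/-- replace-one adjacency: the datasets differ in exactly one coordinate. -/
def AdjReplaceOne {X : Type*} {n : ℕ} (D D' : Fin n → X) : Prop :=
  ∃ i : Fin n, D i ≠ D' i ∧ ∀ j : Fin n, j ≠ i → D j = D' j

/-- joint density of the `T`-step Markov chain (coordinates `Θ_1,…,Θ_T`),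
started at the deterministic point `θ₀`, with transition densities `ptrans t`. -/
def chainDensity {E : Type*} (T : ℕ) (ptrans : ℕ → E → E → ℝ) (θ₀ : E)
    (x : Fin T → E) : ℝ :=
  ∏ t : Fin T,
    ptrans t
      (if 0 < (t : ℕ) then
        x ⟨(t : ℕ) - 1, Nat.lt_of_le_of_lt (Nat.sub_le _ _) t.isLt⟩
      else θ₀)
      (x t)

/-- All iterated forward differences of the sequence are nonnegative. -/
def AbsMonoSeq (p : ℕ → ℝ) : Prop :=
  ∀ j y, 0 ≤ (fwdDiff 1)^[j] p y

lemma AbsMonoSeq.fwdDiff {p : ℕ → ℝ} (hp : AbsMonoSeq p) : AbsMonoSeq (fwdDiff 1 p) :=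
  fun j y => hp (j + 1) y

lemma AbsMonoSeq.shift {p : ℕ → ℝ} (hp : AbsMonoSeq p) : AbsMonoSeq (fun i => p (i + 1)) := by
  intro j y
  have := fwdDiff_iter_comp_add (h := 1) p 1 j y
  rw [this]
  exact hp j _

lemma AbsMonoSeq.mul {p r : ℕ → ℝ} (hp : AbsMonoSeq p) (hr : AbsMonoSeq r) :
    AbsMonoSeq (fun i => p i * r i) := by
  intro j
  induction j generalizing p r with
  | zero => exact fun y => mul_nonneg (hp 0 y) (hr 0 y)
  | succ j ih =>
    intro y
    rw [Function.iterate_succ_apply]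
    have h : _root_.fwdDiff 1 (fun i => p i * r i) =
        (fun i => _root_.fwdDiff 1 p i * r (i + 1)) + fun i => p i * _root_.fwdDiff 1 r i := by
      funext i
      simp only [_root_.fwdDiff, Pi.add_apply]
      ring
    rw [h, fwdDiff_iter_add]
    exact add_nonneg (ih hp.fwdDiff hr.shift y) (ih hp hr.fwdDiff y)

lemma AbsMonoSeq.const {c : ℝ} (hc : 0 ≤ c) : AbsMonoSeq (fun _ => c) := by
  intro j y
  rcases j with _ | j
  · exact hc
  · rw [Function.iterate_succ_apply, fwdDiff_const]
    have : ∀ j, (_root_.fwdDiff 1)^[j] (fun _ : ℕ => (0 : ℝ)) = fun _ => 0 := by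
      intro j
      induction j with
      | zero => rfl
      | succ j ih => rw [Function.iterate_succ_apply, fwdDiff_const, ih]
    rw [this]

lemma absMonoSeq_mul_pred : AbsMonoSeq (fun i => (i : ℝ) * ((i : ℝ) - 1)) := by
  intro j y
  rcases j with _ | j
  · rcases y with _ | y
    · simp
    · simp only [Function.iterate_zero, id_eq]
      push_cast
      have : (0 : ℝ) ≤ y := y.cast_nonneg
      nlinarith
  rcases j with _ | j
  · simp only [Function.iterate_succ, Function.iterate_zero, Function.comp, id_eq, fwdDiff]
    push_cast
    have : (0 : ℝ) ≤ y := y.cast_nonneg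
    nlinarith
  · have h : fwdDiff 1 (fwdDiff 1 (fun i : ℕ => (i : ℝ) * ((i : ℝ) - 1))) = fun _ => 2 := by
      funext i
      simp only [fwdDiff]
      push_cast
      ring
    rw [Function.iterate_succ_apply, Function.iterate_succ_apply, h]
    exact AbsMonoSeq.const (by norm_num) j y

lemma AbsMonoSeq.pow {p : ℕ → ℝ} (hp : AbsMonoSeq p) (n : ℕ) :
    AbsMonoSeq (fun i => p i ^ n) := by
  induction n with
  | zero => simpa using AbsMonoSeq.const zero_le_one
  | succ n ih => simpa only [pow_succ] using ih.mul hp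

lemma AbsMonoSeq.alternating_sum_nonneg {p : ℕ → ℝ} (hp : AbsMonoSeq p) (k : ℕ) :
    0 ≤ ∑ i ∈ range (k + 1), (-1) ^ (k - i) * (k.choose i : ℝ) * p i := by
  have h := hp k 0
  rw [fwdDiff_iter_eq_sum_shift] at h
  simpa [zsmul_eq_mul] using h

/-- The `k`-th Pearson–Vajda moment of two Gaussians whose squared distance, divided by twice the
common variance, is `v`. -/
def gaussMoment (k : ℕ) (v : ℝ) : ℝ :=
  ∑ i ∈ range (k + 1), (-1) ^ (k - i) * (k.choose i : ℝ) * Real.exp (v * ((i : ℝ) * ((i : ℝ) - 1)))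

lemma hasSum_gaussMoment (k : ℕ) (v : ℝ) :
    HasSum (fun n : ℕ => v ^ n / (n.factorial : ℝ) *
      ∑ i ∈ range (k + 1), (-1) ^ (k - i) * (k.choose i : ℝ) * ((i : ℝ) * ((i : ℝ) - 1)) ^ n)
      (gaussMoment k v) := by
  have h : ∀ i ∈ range (k + 1), HasSum (fun n : ℕ => (-1) ^ (k - i) * (k.choose i : ℝ) *
      ((v * ((i : ℝ) * ((i : ℝ) - 1))) ^ n / (n.factorial : ℝ)))
      ((-1) ^ (k - i) * (k.choose i : ℝ) * Real.exp (v * ((i : ℝ) * ((i : ℝ) - 1)))) := by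
    intro i _
    rw [Real.exp_eq_exp_ℝ]
    exact (NormedSpace.expSeries_div_hasSum_exp (v * ((i : ℝ) * ((i : ℝ) - 1)))).mul_left _
  refine (hasSum_sum h).congr_fun ?_
  intro n
  rw [mul_sum]
  refine sum_congr rfl fun i _ => ?_
  rw [mul_pow v]
  ring

lemma gaussMoment_mono (k : ℕ) {v w : ℝ} (hv : 0 ≤ v) (hvw : v ≤ w) :
    gaussMoment k v ≤ gaussMoment k w := by
  refine hasSum_le (fun n => ?_) (hasSum_gaussMoment k v) (hasSum_gaussMoment k w)
  have := (absMonoSeq_mul_pred.pow n).alternating_sum_nonneg k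
  gcongr

/-- Upper bound for the `k`-th absolute Pearson–Vajda moment: the moment itself for even `k`, and
the Cauchy–Schwarz bound for odd `k`. -/
def absGaussMoment (k : ℕ) (v : ℝ) : ℝ :=
  if Even k then gaussMoment k v else Real.sqrt (gaussMoment (k - 1) v * gaussMoment (k + 1) v)

lemma integral_abs_pow_succ_mul_le {Ω : Type*} [MeasurableSpace Ω] {vol : Measure Ω}
    {f w : Ω → ℝ} (hw : ∀ x, 0 ≤ w x) {l : ℕ}
    (hf0 : Integrable (fun x => |f x| ^ (2 * l) * w x) vol)
    (hf1 : Integrable (fun x => |f x| ^ (2 * l + 1) * w x) vol)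
    (hf2 : Integrable (fun x => |f x| ^ (2 * l + 2) * w x) vol) :
    ∫ x, |f x| ^ (2 * l + 1) * w x ∂vol ≤
      Real.sqrt ((∫ x, |f x| ^ (2 * l) * w x ∂vol) * ∫ x, |f x| ^ (2 * l + 2) * w x ∂vol) := by
  apply Real.le_sqrt_of_sq_le
  have key : ∀ t : ℝ, 0 ≤ (∫ x, |f x| ^ (2 * l) * w x ∂vol) * (t * t) +
      (2 * ∫ x, |f x| ^ (2 * l + 1) * w x ∂vol) * t + ∫ x, |f x| ^ (2 * l + 2) * w x ∂vol := by
    intro t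
    have h0 : 0 ≤ ∫ x, ((|f x| ^ (2 * l) * w x) * (t * t) +
        (|f x| ^ (2 * l + 1) * w x) * (2 * t) + |f x| ^ (2 * l + 2) * w x) ∂vol := by
      refine integral_nonneg fun x => ?_
      have : (|f x| ^ (2 * l) * w x) * (t * t) +
        (|f x| ^ (2 * l + 1) * w x) * (2 * t) + |f x| ^ (2 * l + 2) * w x =
          (|f x| ^ l * t + |f x| ^ (l + 1)) ^ 2 * w x := by ring
      simp only [Pi.zero_apply]
      rw [this]
      exact mul_nonneg (sq_nonneg _) (hw x)
    have h01 : Integrable (fun x => (|f x| ^ (2 * l) * w x) * (t * t) +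
        (|f x| ^ (2 * l + 1) * w x) * (2 * t)) vol :=
      (hf0.mul_const _).add (hf1.mul_const _)
    rw [integral_add h01 hf2,
      integral_add (hf0.mul_const _) (hf1.mul_const _), integral_mul_const,
      integral_mul_const] at h0
    linarith
  have := discrim_le_zero key
  unfold discrim at this
  nlinarith

lemma gaussMoment_nonneg {k : ℕ} (hk : 1 ≤ k) {v : ℝ} (hv : 0 ≤ v) : 0 ≤ gaussMoment k v := by
  refine le_trans (le_of_eq ?_) (gaussMoment_mono k le_rfl hv)
  have h := add_pow (1 : ℝ) (-1) k
  simp only [gaussMoment, zero_mul, Real.exp_zero, mul_one]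
  rw [add_neg_cancel, zero_pow (by omega)] at h
  rw [h]
  exact sum_congr rfl fun i _ => by ring

section GaussianDensity

variable {V : Type*} [NormedAddCommGroup V]

/-- Isotropic Gaussian-shaped density `c * exp (-β ‖x - μ‖²)`. -/
def isoDensity (c β : ℝ) (μ x : V) : ℝ :=
  c * Real.exp (-β * ‖x - μ‖ ^ 2)

lemma isoDensity_pos {c : ℝ} (hc : 0 < c) (β : ℝ) (μ x : V) : 0 < isoDensity c β μ x :=
  mul_pos hc (Real.exp_pos _)

lemma continuous_isoDensity (c β : ℝ) (μ : V) : Continuous (isoDensity c β μ) := by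
  unfold isoDensity
  fun_prop

lemma integral_isoDensity [MeasurableSpace V] [BorelSpace V] {vol : Measure V}
    [vol.IsAddRightInvariant] {c β : ℝ}
    (h1 : ∫ x, isoDensity c β (0 : V) x ∂vol = 1) (μ : V) :
    Integrable (isoDensity c β μ) vol ∧ ∫ x, isoDensity c β μ x ∂vol = 1 := by
  have h : isoDensity c β μ = fun x => isoDensity c β 0 (x - μ) := by
    funext x
    simp [isoDensity]
  have hint : Integrable (isoDensity c β (0 : V)) vol := by
    by_contra hn
    rw [integral_undef hn] at h1
    norm_num at h1
  rw [h]
  refine ⟨hint.comp_sub_right μ, ?_⟩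
  rw [integral_sub_right_eq_self (fun x => isoDensity c β 0 x) μ, h1]

variable [InnerProductSpace ℝ V]

lemma isoDensity_div {c : ℝ} (hc : 0 < c) (β : ℝ) (μ ν x : V) :
    isoDensity c β μ x / isoDensity c β ν x =
      Real.exp (2 * β * inner ℝ (x - ν) (μ - ν) - β * ‖μ - ν‖ ^ 2) := by
  unfold isoDensity
  rw [mul_div_mul_left _ _ hc.ne', ← Real.exp_sub]
  congr 1
  have h : x - μ = (x - ν) - (μ - ν) := by abel
  rw [h, norm_sub_sq_real (x - ν) (μ - ν)]
  ring

lemma exp_inner_mul_isoDensity (c β : ℝ) (ν w x : V) :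
    Real.exp (2 * β * inner ℝ (x - ν) w) * isoDensity c β ν x =
      Real.exp (β * ‖w‖ ^ 2) * isoDensity c β (ν + w) x := by
  unfold isoDensity
  rw [mul_left_comm, mul_left_comm (Real.exp _) c, ← Real.exp_add, ← Real.exp_add]
  congr 2
  have h : x - (ν + w) = (x - ν) - w := by abel
  rw [h, norm_sub_sq_real (x - ν) w]
  ring

lemma isoDensity_ratio_pow_mul {c : ℝ} (hc : 0 < c) (β : ℝ) (μ₁ μ₂ ν x : V) (i j : ℕ) :
    (isoDensity c β μ₁ x / isoDensity c β ν x) ^ i *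
        (isoDensity c β μ₂ x / isoDensity c β ν x) ^ j * isoDensity c β ν x =
      Real.exp (β * ‖(i : ℝ) • (μ₁ - ν) + (j : ℝ) • (μ₂ - ν)‖ ^ 2 -
          i * (β * ‖μ₁ - ν‖ ^ 2) - j * (β * ‖μ₂ - ν‖ ^ 2)) *
        isoDensity c β (ν + ((i : ℝ) • (μ₁ - ν) + (j : ℝ) • (μ₂ - ν))) x := by
  rw [isoDensity_div hc, isoDensity_div hc, ← Real.exp_nat_mul, ← Real.exp_nat_mul,
    ← Real.exp_add, sub_sub, sub_eq_neg_add (β * _), Real.exp_add (-_),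
    mul_assoc (Real.exp (-_)),
    ← exp_inner_mul_isoDensity, ← mul_assoc (Real.exp (-_)), ← Real.exp_add]
  congr 2
  rw [inner_add_right, inner_smul_right, inner_smul_right]
  ring

variable [MeasurableSpace V] [BorelSpace V]

lemma integral_isoDensity_ratio_pow_mul {vol : Measure V} [vol.IsAddRightInvariant] {c β : ℝ}
    (hc : 0 < c) (h1 : ∫ x, isoDensity c β (0 : V) x ∂vol = 1) (μ₁ μ₂ ν : V) (i j : ℕ) :
    Integrable (fun x => (isoDensity c β μ₁ x / isoDensity c β ν x) ^ i *
        (isoDensity c β μ₂ x / isoDensity c β ν x) ^ j * isoDensity c β ν x) vol ∧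
    ∫ x, (isoDensity c β μ₁ x / isoDensity c β ν x) ^ i *
        (isoDensity c β μ₂ x / isoDensity c β ν x) ^ j * isoDensity c β ν x ∂vol =
      Real.exp (β * ‖(i : ℝ) • (μ₁ - ν) + (j : ℝ) • (μ₂ - ν)‖ ^ 2 -
          i * (β * ‖μ₁ - ν‖ ^ 2) - j * (β * ‖μ₂ - ν‖ ^ 2)) := by
  simp_rw [isoDensity_ratio_pow_mul hc]
  have h := integral_isoDensity h1 (ν + ((i : ℝ) • (μ₁ - ν) + (j : ℝ) • (μ₂ - ν)))
  exact ⟨h.1.const_mul _, by rw [integral_const_mul, h.2, mul_one]⟩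

lemma integral_isoDensity_ratio_pow {vol : Measure V} [vol.IsAddRightInvariant] {c β : ℝ}
    (hc : 0 < c) (h1 : ∫ x, isoDensity c β (0 : V) x ∂vol = 1) (μ ν : V) (i : ℕ) :
    Integrable (fun x => (isoDensity c β μ x / isoDensity c β ν x) ^ i * isoDensity c β ν x) vol ∧
    ∫ x, (isoDensity c β μ x / isoDensity c β ν x) ^ i * isoDensity c β ν x ∂vol =
      Real.exp (β * ‖μ - ν‖ ^ 2 * ((i : ℝ) * ((i : ℝ) - 1))) := by
  have h := integral_isoDensity_ratio_pow_mul hc h1 μ μ ν i 0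
  simp only [pow_zero, mul_one, Nat.cast_zero, zero_smul, add_zero, zero_mul, sub_zero] at h
  refine ⟨h.1, h.2.trans ?_⟩
  rw [norm_smul, Real.norm_natCast]
  congr 1
  ring

lemma integral_isoDensity_ratio_sub_one_pow {vol : Measure V} [vol.IsAddRightInvariant] {c β : ℝ}
    (hc : 0 < c) (h1 : ∫ x, isoDensity c β (0 : V) x ∂vol = 1) (μ ν : V) (k : ℕ) :
    Integrable (fun x => (isoDensity c β μ x / isoDensity c β ν x - 1) ^ k *
      isoDensity c β ν x) vol ∧
    ∫ x, (isoDensity c β μ x / isoDensity c β ν x - 1) ^ k * isoDensity c β ν x ∂vol =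
      gaussMoment k (β * ‖μ - ν‖ ^ 2) := by
  have h : ∀ x, (isoDensity c β μ x / isoDensity c β ν x - 1) ^ k * isoDensity c β ν x =
      ∑ i ∈ range (k + 1), (-1) ^ (k - i) * (k.choose i : ℝ) *
        ((isoDensity c β μ x / isoDensity c β ν x) ^ i * isoDensity c β ν x) := by
    intro x
    rw [sub_eq_add_neg, add_pow, sum_mul]
    exact sum_congr rfl fun i _ => by ring
  have hi := integral_isoDensity_ratio_pow hc h1 μ ν
  simp_rw [h]
  refine ⟨integrable_finsetSum _ fun i _ => (hi i).1.const_mul _, ?_⟩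
  rw [integral_finsetSum _ fun i _ => (hi i).1.const_mul _]
  simp_rw [integral_const_mul, (hi _).2]
  rfl

lemma integral_abs_isoDensity_ratio_sub_one_pow_le {vol : Measure V} [vol.IsAddRightInvariant]
    {c β : ℝ} (hc : 0 < c) (hβ : 0 ≤ β) (h1 : ∫ x, isoDensity c β (0 : V) x ∂vol = 1) (μ ν : V)
    {v : ℝ} (hv : β * ‖μ - ν‖ ^ 2 ≤ v) (k : ℕ) :
    Integrable (fun x => |isoDensity c β μ x / isoDensity c β ν x - 1| ^ k *
      isoDensity c β ν x) vol ∧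
    ∫ x, |isoDensity c β μ x / isoDensity c β ν x - 1| ^ k * isoDensity c β ν x ∂vol ≤
      absGaussMoment k v := by
  have hv0 : 0 ≤ β * ‖μ - ν‖ ^ 2 := by positivity
  have hint : ∀ k, Integrable (fun x => |isoDensity c β μ x / isoDensity c β ν x - 1| ^ k *
      isoDensity c β ν x) vol := by
    intro k
    refine (integral_isoDensity_ratio_sub_one_pow hc h1 μ ν k).1.abs.congr ?_
    refine Filter.Eventually.of_forall fun x => ?_
    simp only
    rw [abs_mul, abs_pow, abs_of_pos (isoDensity_pos hc β ν x)]
  have heven : ∀ l, ∫ x, |isoDensity c β μ x / isoDensity c β ν x - 1| ^ (2 * l) *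
      isoDensity c β ν x ∂vol ≤ gaussMoment (2 * l) v := by
    intro l
    simp_rw [(even_two_mul l).pow_abs]
    rw [(integral_isoDensity_ratio_sub_one_pow hc h1 μ ν (2 * l)).2]
    exact gaussMoment_mono _ hv0 hv
  refine ⟨hint k, ?_⟩
  unfold absGaussMoment
  rcases Nat.even_or_odd' k with ⟨l, rfl | rfl⟩
  · rw [if_pos (even_two_mul l)]
    exact heven l
  · rw [if_neg (by simp)]
    refine (integral_abs_pow_succ_mul_le (fun x => (isoDensity_pos hc β ν x).le)
      (hint _) (hint _) (hint _)).trans (Real.sqrt_le_sqrt ?_)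
    have h2 := heven (l + 1)
    have h3 := heven l
    rw [Nat.add_sub_cancel]
    refine mul_le_mul h3 h2 (integral_nonneg fun x => ?_)
      (le_trans (integral_nonneg fun x => ?_) h3)
    all_goals exact mul_nonneg (by positivity) (isoDensity_pos hc β ν x).le

end GaussianDensity

lemma hasDerivAt_pow_div_factorial (n : ℕ) (t : ℝ) :
    HasDerivAt (fun t : ℝ => t ^ (n + 1) / ((n + 1).factorial : ℝ)) (t ^ n / (n.factorial : ℝ)) t := by
  refine ((hasDerivAt_pow (n + 1) t).div_const _).congr_deriv ?_
  have h : (n.factorial : ℝ) ≠ 0 := by positivity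
  have h' : (n : ℝ) + 1 ≠ 0 := by positivity
  rw [Nat.factorial_succ]
  push_cast
  field_simp

/-- Taylor's inequality when the `m`-th derivative is dominated by a sum of polynomials. -/
lemma taylor_le_of_deriv_le_polynomial {ι : Type*} (S : Finset ι) (κ : ι → ℝ) (d : ι → ℕ → ℝ)
    (N : ι → ℕ) {q : ℝ} (m : ℕ) (φ : ℕ → ℝ → ℝ)
    (hφ : ∀ j, ∀ t ∈ Set.Icc 0 q, HasDerivAt (φ j) (φ (j + 1) t) t)
    (hle : ∀ t ∈ Set.Icc 0 q, φ m t ≤ ∑ i ∈ S, (κ i + ∑ l ∈ range (N i), d i l * t ^ l)) :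
    ∀ t ∈ Set.Icc 0 q, φ 0 t ≤ ∑ j ∈ range m, φ j 0 * (t ^ j / (j.factorial : ℝ)) +
      ∑ i ∈ S, (κ i * (t ^ m / (m.factorial : ℝ)) + ∑ l ∈ range (N i),
        d i l * (l.factorial * (t ^ (m + l) / ((m + l).factorial : ℝ)))) := by
  induction m generalizing φ with
  | zero =>
    intro t ht
    refine (hle t ht).trans (le_of_eq ?_)
    simp only [range_zero, sum_empty, zero_add, pow_zero, Nat.factorial_zero, Nat.cast_one,
      div_one, mul_one]
    refine sum_congr rfl fun i _ => ?_
    congr 1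
    refine sum_congr rfl fun l _ => ?_
    rw [mul_div_cancel₀ _ (by positivity)]
  | succ m ih =>
    have h1 := ih (fun j => φ (j + 1)) (fun j t ht => hφ (j + 1) t ht) hle
    have hd : ∀ t : ℝ, HasDerivAt (fun t => ∑ j ∈ range (m + 1), φ j 0 * (t ^ j / (j.factorial : ℝ)) +
        ∑ i ∈ S, (κ i * (t ^ (m + 1) / ((m + 1).factorial : ℝ)) + ∑ l ∈ range (N i),
          d i l * (l.factorial * (t ^ (m + 1 + l) / ((m + 1 + l).factorial : ℝ)))))
        (∑ j ∈ range m, φ (j + 1) 0 * (t ^ j / (j.factorial : ℝ)) +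
        ∑ i ∈ S, (κ i * (t ^ m / (m.factorial : ℝ)) + ∑ l ∈ range (N i),
          d i l * (l.factorial * (t ^ (m + l) / ((m + l).factorial : ℝ))))) t := by
      intro t
      simp only [sum_range_succ' (n := m)]
      refine HasDerivAt.add ?_ (HasDerivAt.fun_sum fun i _ => ?_)
      · simpa using (HasDerivAt.fun_sum fun j (_ : j ∈ range m) =>
          (hasDerivAt_pow_div_factorial j t).const_mul (φ (j + 1) 0)).add_const (φ 0 0)
      · refine ((hasDerivAt_pow_div_factorial m t).const_mul _).add
          (HasDerivAt.fun_sum fun l _ => ?_)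
        have := hasDerivAt_pow_div_factorial (m + l) t
        rw [add_right_comm] at this
        exact (this.const_mul _).const_mul _
    intro t ht
    refine image_le_of_deriv_right_le_deriv_boundary (a := 0) (b := q)
      (fun x hx => (hφ 0 x hx).continuousAt.continuousWithinAt)
      (fun x hx => (hφ 0 x ⟨hx.1, hx.2.le⟩).hasDerivWithinAt) ?_
      (fun x _ => (hd x).continuousAt.continuousWithinAt)
      (fun x _ => (hd x).hasDerivWithinAt) (fun x hx => h1 x ⟨hx.1, hx.2.le⟩) ht
    simp only [sum_range_succ' (n := m)]
    simp [add_right_comm m 1]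

/-- The falling product `γ (γ - 1) ⋯ (γ - i + 1)`. -/
def fallProd (γ : ℝ) (i : ℕ) : ℝ :=
  ∏ l ∈ range i, (γ - (l : ℝ))

/-- The `i`-th derivative of `t ↦ (1 + t * a) ^ γ`. -/
def rpowDeriv (γ a : ℝ) (i : ℕ) (t : ℝ) : ℝ :=
  fallProd γ i * a ^ i * (1 + t * a) ^ (γ - (i : ℝ))

lemma hasDerivAt_rpowDeriv (γ a : ℝ) (i : ℕ) {t : ℝ} (ht : 0 < 1 + t * a) :
    HasDerivAt (rpowDeriv γ a i) (rpowDeriv γ a (i + 1) t) t := by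
  have h : HasDerivAt (fun t : ℝ => 1 + t * a) a t := by
    simpa using ((hasDerivAt_id t).mul_const a).const_add 1
  refine ((h.rpow_const (p := γ - (i : ℝ)) (Or.inl ht.ne')).const_mul
    (fallProd γ i * a ^ i)).congr_deriv ?_
  simp only [rpowDeriv, fallProd, prod_range_succ]
  push_cast
  rw [← sub_sub]
  ring

/-- The Leibniz formula for the `j`-th derivative of `t ↦ (1 + t * a) ^ α * (1 + t * b) ^ (1 - α)`. -/
def mixDeriv (α a b : ℝ) (j : ℕ) (t : ℝ) : ℝ :=
  ∑ ij ∈ antidiagonal j, (j.choose ij.1 : ℝ) * (rpowDeriv α a ij.1 t * rpowDeriv (1 - α) b ij.2 t)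

lemma hasDerivAt_mixDeriv (α a b : ℝ) (j : ℕ) {t : ℝ} (ha : 0 < 1 + t * a) (hb : 0 < 1 + t * b) :
    HasDerivAt (mixDeriv α a b j) (mixDeriv α a b (j + 1) t) t := by
  unfold mixDeriv
  rw [sum_antidiagonal_choose_succ_mul (fun i j => rpowDeriv α a i t * rpowDeriv (1 - α) b j t),
    ← sum_add_distrib]
  refine HasDerivAt.fun_sum fun ij hij => ?_
  refine (((hasDerivAt_rpowDeriv α a ij.1 ha).mul
    (hasDerivAt_rpowDeriv (1 - α) b ij.2 hb)).const_mul _).congr_deriv ?_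
  rw [← Nat.choose_symm_of_eq_add (mem_antidiagonal.1 hij).symm]
  ring

lemma abs_fallProd (γ : ℝ) (i : ℕ) : |fallProd γ i| = ∏ l ∈ range i, |γ - (l : ℝ)| :=
  abs_prod _ _

lemma fallProd_one_sub (α : ℝ) (i : ℕ) :
    fallProd (1 - α) i = (-1) ^ i * ∏ l ∈ range i, (α + (l : ℝ) - 1) := by
  rw [fallProd, ← card_range i, ← prod_const, card_range, ← prod_mul_distrib]
  exact prod_congr rfl fun l _ => by ring

lemma prod_add_sub_one_nonneg {α : ℝ} (hα : 1 < α) (i : ℕ) :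
    0 ≤ ∏ l ∈ range i, (α + (l : ℝ) - 1) :=
  prod_nonneg fun l _ => by
    have : (0 : ℝ) ≤ l := l.cast_nonneg
    linarith

lemma abs_fallProd_one_sub {α : ℝ} (hα : 1 < α) (i : ℕ) :
    |fallProd (1 - α) i| = ∏ l ∈ range i, (α + (l : ℝ) - 1) := by
  rw [fallProd_one_sub, abs_mul, abs_pow, abs_neg, abs_one, one_pow, one_mul,
    abs_of_nonneg (prod_add_sub_one_nonneg hα i)]

lemma one_sub_le_one_add_mul {a q t : ℝ} (ha : -1 ≤ a) (ht : t ∈ Set.Icc 0 q) :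
    1 - q ≤ 1 + t * a := by
  nlinarith [ht.1, ht.2]

lemma rpow_one_add_mul_le {a q t γ : ℝ} (ha : -1 ≤ a) (hq : q < 1) (ht : t ∈ Set.Icc 0 q)
    (hγ : 0 ≤ γ) {N : ℕ} (hN : γ ≤ N) :
    (1 + t * a) ^ γ ≤ 1 + ∑ l ∈ range (N + 1), (N.choose l : ℝ) * |a| ^ l * t ^ l := by
  have hpos : 0 < 1 + t * a := (sub_pos.2 hq).trans_le (one_sub_le_one_add_mul ha ht)
  have hsum : ∑ l ∈ range (N + 1), (N.choose l : ℝ) * |a| ^ l * t ^ l = (t * |a| + 1) ^ N := by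
    rw [add_pow]
    exact sum_congr rfl fun l _ => by rw [mul_pow]; ring
  have h0 : 0 ≤ t * |a| := mul_nonneg ht.1 (abs_nonneg a)
  rw [hsum]
  rcases le_total (1 + t * a) 1 with h | h
  · have := Real.rpow_le_one hpos.le h hγ
    have : 0 ≤ (t * |a| + 1) ^ N := by positivity
    linarith
  · calc (1 + t * a) ^ γ ≤ (1 + t * a) ^ (N : ℝ) := Real.rpow_le_rpow_of_exponent_le h hN
      _ = (1 + t * a) ^ N := Real.rpow_natCast _ _
      _ ≤ (t * |a| + 1) ^ N := by
        refine pow_le_pow_left₀ hpos.le ?_ N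
        have := mul_le_mul_of_nonneg_left (le_abs_self a) ht.1
        linarith
      _ ≤ 1 + (t * |a| + 1) ^ N := by linarith

/-- The weight of the `i`-th Leibniz term in the Taylor remainder. -/
def remWeight (α q : ℝ) (m i : ℕ) : ℝ :=
  (1 - q) ^ (-(α + (m : ℝ) - (i : ℝ) - 1)) * (m.choose i : ℝ) *
    (∏ l ∈ range i, |α - (l : ℝ)|) * (∏ l ∈ range (m - i), (α + (l : ℝ) - 1))

lemma remWeight_nonneg {α q : ℝ} (hα : 1 < α) (hq : q < 1) (m i : ℕ) : 0 ≤ remWeight α q m i := by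
  have h1 : 0 ≤ 1 - q := by linarith
  have h2 := prod_add_sub_one_nonneg hα (m - i)
  have h3 : 0 ≤ ∏ l ∈ range i, |α - (l : ℝ)| := prod_nonneg fun l _ => abs_nonneg _
  unfold remWeight
  positivity

lemma mixDeriv_le {α a b q t : ℝ} (hα : 1 < α) (hq : q < 1) (ha : -1 ≤ a) (hb : -1 ≤ b)
    (ht : t ∈ Set.Icc 0 q) (m : ℕ) :
    mixDeriv α a b m t ≤ ∑ i ∈ range (m + 1),
      (remWeight α q m i * (|a| ^ i * |b| ^ (m - i)) *
          (if α ≤ (i : ℝ) then (1 - q) ^ (α - (i : ℝ)) else 1) +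
        ∑ l ∈ range (if α ≤ (i : ℝ) then 0 else ⌈α⌉₊ - i + 1),
          remWeight α q m i * (|a| ^ (i + l) * |b| ^ (m - i)) * ((⌈α⌉₊ - i).choose l : ℝ) *
            t ^ l) := by
  have h1q : 0 < 1 - q := sub_pos.2 hq
  have hqa := one_sub_le_one_add_mul ha ht
  have hqb := one_sub_le_one_add_mul hb ht
  have hpa := h1q.trans_le hqa
  have hpb := h1q.trans_le hqb
  unfold mixDeriv
  rw [Nat.sum_antidiagonal_eq_sum_range_succ
    (fun i j => (m.choose i : ℝ) * (rpowDeriv α a i t * rpowDeriv (1 - α) b j t))]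
  refine sum_le_sum fun i hi => ?_
  have him : i ≤ m := Nat.lt_succ_iff.1 (mem_range.1 hi)
  have hB : (1 + t * b) ^ (1 - α - ((m - i : ℕ) : ℝ)) ≤
      (1 - q) ^ (-(α + (m : ℝ) - (i : ℝ) - 1)) := by
    have h2 : (0 : ℝ) ≤ ((m - i : ℕ) : ℝ) := Nat.cast_nonneg _
    refine (Real.rpow_le_rpow_of_nonpos h1q hqb (by linarith)).trans (le_of_eq ?_)
    rw [Nat.cast_sub him]
    congr 1
    ring
  have hA : (1 + t * a) ^ (α - (i : ℝ)) ≤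
      (if α ≤ (i : ℝ) then (1 - q) ^ (α - (i : ℝ)) else 1) +
        ∑ l ∈ range (if α ≤ (i : ℝ) then 0 else ⌈α⌉₊ - i + 1),
          ((⌈α⌉₊ - i).choose l : ℝ) * |a| ^ l * t ^ l := by
    split_ifs with h
    · simpa using Real.rpow_le_rpow_of_nonpos h1q hqa (by linarith)
    · refine rpow_one_add_mul_le ha hq ht (by linarith) ?_
      have h3 : i ≤ ⌈α⌉₊ := by
        have := Nat.le_ceil α
        exact_mod_cast (not_le.1 h).le.trans this
      rw [Nat.cast_sub h3]
      linarith [Nat.le_ceil α]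
  have h0A : 0 ≤ (1 + t * a) ^ (α - (i : ℝ)) := by positivity
  have h0B : 0 ≤ (1 + t * b) ^ (1 - α - ((m - i : ℕ) : ℝ)) := by positivity
  calc (m.choose i : ℝ) * (rpowDeriv α a i t * rpowDeriv (1 - α) b (m - i) t)
      ≤ |(m.choose i : ℝ) * (rpowDeriv α a i t * rpowDeriv (1 - α) b (m - i) t)| := le_abs_self _
    _ = (m.choose i : ℝ) * |fallProd α i| * |fallProd (1 - α) (m - i)| * (|a| ^ i * |b| ^ (m - i)) *
          ((1 + t * b) ^ (1 - α - ((m - i : ℕ) : ℝ)) * (1 + t * a) ^ (α - (i : ℝ))) := by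
        simp only [rpowDeriv, abs_mul, abs_pow, Nat.abs_cast, abs_of_nonneg h0A, abs_of_nonneg h0B]
        ring
    _ ≤ (m.choose i : ℝ) * |fallProd α i| * |fallProd (1 - α) (m - i)| * (|a| ^ i * |b| ^ (m - i)) *
          ((1 - q) ^ (-(α + (m : ℝ) - (i : ℝ) - 1)) *
            ((if α ≤ (i : ℝ) then (1 - q) ^ (α - (i : ℝ)) else 1) +
              ∑ l ∈ range (if α ≤ (i : ℝ) then 0 else ⌈α⌉₊ - i + 1),
                ((⌈α⌉₊ - i).choose l : ℝ) * |a| ^ l * t ^ l)) := by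
        refine mul_le_mul_of_nonneg_left (mul_le_mul hB hA h0A (by positivity)) (by positivity)
    _ = _ := by
        rw [abs_fallProd, abs_fallProd_one_sub hα, remWeight, mul_add, mul_add, mul_sum, mul_sum]
        congr 1
        · ring
        · exact sum_congr rfl fun l _ => by ring

/-- The `j`-th Taylor coefficient (times `j!`) of `t ↦ (1 + t * a) ^ α * (1 + t * b) ^ (1 - α)`
at `0`. -/
def mixCoeff (α a b : ℝ) (j : ℕ) : ℝ :=
  ∑ i ∈ range (j + 1),
    (j.choose i : ℝ) * (fallProd α i * fallProd (1 - α) (j - i)) * (a ^ i * b ^ (j - i))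

lemma mixDeriv_zero (α a b : ℝ) (j : ℕ) : mixDeriv α a b j 0 = mixCoeff α a b j := by
  unfold mixDeriv mixCoeff
  rw [Nat.sum_antidiagonal_eq_sum_range_succ
    (fun i l => (j.choose i : ℝ) * (rpowDeriv α a i 0 * rpowDeriv (1 - α) b l 0))]
  refine sum_congr rfl fun i _ => ?_
  simp only [rpowDeriv, zero_mul, add_zero, Real.one_rpow, mul_one]
  ring

/-- Upper bound for the `i`-th term of the Taylor remainder. -/
def remTerm (α q : ℝ) (m i : ℕ) (B : ℕ → ℕ → ℝ) : ℝ :=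
  if α ≤ (i : ℝ) then (1 - q) ^ (α - (i : ℝ)) * B i (m - i)
  else B i (m - i) + ∑ l ∈ range (⌈α⌉₊ - i + 1),
    q ^ l * ((⌈α⌉₊ - i).factorial : ℝ) * (m.factorial : ℝ) /
      (((⌈α⌉₊ - i - l).factorial : ℝ) * ((m + l).factorial : ℝ)) * B (i + l) (m - i)

/-- Upper bound for the Taylor expansion of order `m` at `q`. -/
def taylorBound (α q : ℝ) (m : ℕ) (a b : ℝ) : ℝ :=
  ∑ j ∈ range m, q ^ j / (j.factorial : ℝ) * mixCoeff α a b j +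
    q ^ m / (m.factorial : ℝ) * ∑ i ∈ range (m + 1),
      remWeight α q m i * remTerm α q m i (fun r s => |a| ^ r * |b| ^ s)

lemma rpow_mul_rpow_le_taylorBound {α a b q : ℝ} (hα : 1 < α) (hq0 : 0 ≤ q) (hq : q < 1)
    (ha : -1 ≤ a) (hb : -1 ≤ b) (m : ℕ) :
    (1 + q * a) ^ α * (1 + q * b) ^ (1 - α) ≤ taylorBound α q m a b := by
  have h := taylor_le_of_deriv_le_polynomial (q := q) (range (m + 1)) _ _ _ m (mixDeriv α a b)
    (fun j t ht => hasDerivAt_mixDeriv α a b j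
      ((sub_pos.2 hq).trans_le (one_sub_le_one_add_mul ha ht))
      ((sub_pos.2 hq).trans_le (one_sub_le_one_add_mul hb ht)))
    (fun t ht => mixDeriv_le hα hq ha hb ht m) q ⟨hq0, le_rfl⟩
  have h0 : mixDeriv α a b 0 q = (1 + q * a) ^ α * (1 + q * b) ^ (1 - α) := by
    simp [mixDeriv, rpowDeriv, fallProd]
  rw [h0] at h
  refine h.trans (le_of_eq ?_)
  unfold taylorBound
  rw [mul_sum]
  congr 1
  · exact sum_congr rfl fun j _ => by rw [mixDeriv_zero]; ring
  refine sum_congr rfl fun i _ => ?_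
  unfold remTerm
  split_ifs with hi
  · simp only [range_zero, sum_empty]
    ring
  · rw [mul_add, mul_add, mul_sum, mul_sum]
    congr 1
    · ring
    refine sum_congr rfl fun l hl => ?_
    have hl : l ≤ ⌈α⌉₊ - i := Nat.lt_succ_iff.1 (mem_range.1 hl)
    rw [Nat.cast_choose ℝ hl, pow_add q m l]
    have h1 : (l.factorial : ℝ) ≠ 0 := by positivity
    have h2 : (m.factorial : ℝ) ≠ 0 := by positivity
    have h3 : ((m + l).factorial : ℝ) ≠ 0 := by positivity
    have h4 : ((⌈α⌉₊ - i - l).factorial : ℝ) ≠ 0 := by positivity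
    field_simp

lemma abs_pow_mul_abs_pow_le (a b : ℝ) {r s : ℕ} (h : 0 < r + s) :
    |a| ^ r * |b| ^ s ≤
      (r : ℝ) / ((r + s : ℕ) : ℝ) * |a| ^ (r + s) + (s : ℝ) / ((r + s : ℕ) : ℝ) * |b| ^ (r + s) := by
  have hk : ((r + s : ℕ) : ℝ) ≠ 0 := by positivity
  have hpow : ∀ (c : ℝ) (n : ℕ), (|c| ^ (r + s)) ^ ((n : ℝ) / ((r + s : ℕ) : ℝ)) = |c| ^ n := by
    intro c n
    rw [← Real.rpow_natCast, ← Real.rpow_mul (abs_nonneg c), mul_div_cancel₀ _ hk,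
      Real.rpow_natCast]
  have := Real.geom_mean_le_arith_mean2_weighted (w₁ := (r : ℝ) / ((r + s : ℕ) : ℝ))
    (w₂ := (s : ℝ) / ((r + s : ℕ) : ℝ)) (p₁ := |a| ^ (r + s)) (p₂ := |b| ^ (r + s))
    (by positivity) (by positivity) (by positivity) (by positivity)
    (by rw [← add_div, ← Nat.cast_add, div_self hk])
  rwa [hpow, hpow] at this

lemma sub_pow_le_of_lt {x y : ℝ} (hy : 0 < y) (hxy : y ≤ x) {j : ℕ} (hj : 1 ≤ j) :
    (x - y) ^ j ≤ |x - 1| ^ j + |x / y - 1| ^ j * y := by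
  have h0 : 0 ≤ x - y := sub_nonneg.2 hxy
  rcases le_total 1 y with h | h
  · have h1 : (x - y) ^ j ≤ |x - 1| ^ j :=
      pow_le_pow_left₀ h0 (le_trans (by linarith) (le_abs_self _)) j
    have : 0 ≤ |x / y - 1| ^ j * y := by positivity
    linarith
  · have h1 : (x - y) ^ j ≤ |x / y - 1| ^ j * y := by
      have h2 : |x / y - 1| = (x - y) / y := by
        rw [div_sub_one hy.ne', abs_of_nonneg (by positivity)]
      obtain ⟨i, rfl⟩ := Nat.exists_eq_add_of_le' hj
      rw [h2, div_pow, div_mul_eq_mul_div, pow_succ y, mul_div_mul_right _ _ hy.ne']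
      exact le_div_self (by positivity) (by positivity) (pow_le_one₀ hy.le h)
    have : 0 ≤ |x - 1| ^ j := by positivity
    linarith

/-- Moment bounds for a pair of likelihood ratios with respect to a common reference measure. -/
structure MomentBounds {Ω : Type*} [MeasurableSpace Ω] (P : Measure Ω) (x y : Ω → ℝ)
    (B : ℕ → ℝ) (K : ℝ) : Prop where
  measurable_left : Measurable x
  measurable_right : Measurable y
  left_pos : ∀ ω, 0 < x ω
  right_pos : ∀ ω, 0 < y ω
  integral_left : ∫ ω, (x ω - 1) ∂P = 0
  integral_right : ∫ ω, (y ω - 1) ∂P = 0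
  integral_sq : ∫ ω, (x ω - y ω) ^ 2 ∂P ≤ 2 * K
  left : ∀ k, Integrable (fun ω => |x ω - 1| ^ k) P ∧ ∫ ω, |x ω - 1| ^ k ∂P ≤ B k
  right : ∀ k, Integrable (fun ω => |y ω - 1| ^ k) P ∧ ∫ ω, |y ω - 1| ^ k ∂P ≤ B k
  left_right : ∀ k, Integrable (fun ω => |x ω / y ω - 1| ^ k * y ω) P ∧
    ∫ ω, |x ω / y ω - 1| ^ k * y ω ∂P ≤ B k
  right_left : ∀ k, Integrable (fun ω => |y ω / x ω - 1| ^ k * x ω) P ∧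
    ∫ ω, |y ω / x ω - 1| ^ k * x ω ∂P ≤ B k

/-- The relative deviation of the `i`-th Leibniz coefficient of order `k` from the corresponding
coefficient of `(a - b) ^ k`. -/
def leibnizDefect (α : ℝ) (k i : ℕ) : ℝ :=
  α / (α - 1) * (∏ l ∈ range i, (1 - (l : ℝ) / α)) *
    (∏ l ∈ range (k - i), (1 + ((l : ℝ) - 1) / α)) - 1

lemma fallProd_mul_fallProd {α : ℝ} (hα : 1 < α) {k i : ℕ} (hk : 1 ≤ k) (hi : i ≤ k) :
    fallProd α i * fallProd (1 - α) (k - i) =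
      (α - 1) * α ^ (k - 1) * ((-1) ^ (k - i) * (1 + leibnizDefect α k i)) := by
  have h0 : α ≠ 0 := by positivity
  have h1 : α - 1 ≠ 0 := by linarith
  have hA : fallProd α i = α ^ i * ∏ l ∈ range i, (1 - (l : ℝ) / α) := by
    rw [fallProd, ← card_range i, ← prod_const, card_range, ← prod_mul_distrib]
    exact prod_congr rfl fun l _ => by field_simp
  have hB : fallProd (1 - α) (k - i) =
      (-1) ^ (k - i) * (α ^ (k - i) * ∏ l ∈ range (k - i), (1 + ((l : ℝ) - 1) / α)) := by
    rw [fallProd_one_sub]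
    congr 1
    nth_rewrite 2 [← card_range (k - i)]
    rw [← prod_const, ← prod_mul_distrib]
    refine prod_congr rfl fun l _ => ?_
    field_simp
    ring
  have hp : α ^ k = (α - 1) * α ^ (k - 1) * (α / (α - 1)) := by
    obtain ⟨n, rfl⟩ := Nat.exists_eq_add_of_le' hk
    rw [Nat.add_sub_cancel, pow_succ]
    field_simp
  have hpp : α ^ i * α ^ (k - i) = α ^ k := by rw [← pow_add, Nat.add_sub_cancel' hi]
  rw [hA, hB, leibnizDefect, add_sub_cancel]
  calc _ = (α ^ i * α ^ (k - i)) * ((-1) ^ (k - i) * ((∏ l ∈ range i, (1 - (l : ℝ) / α)) *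
        ∏ l ∈ range (k - i), (1 + ((l : ℝ) - 1) / α))) := by ring
    _ = _ := by rw [hpp, hp]; ring

lemma mixCoeff_eq {α : ℝ} (hα : 1 < α) (a b : ℝ) {k : ℕ} (hk : 1 ≤ k) :
    mixCoeff α a b k = (α - 1) * α ^ (k - 1) * ((a - b) ^ k + ∑ i ∈ range (k + 1),
      (k.choose i : ℝ) * ((-1) ^ (k - i) * leibnizDefect α k i) * (a ^ i * b ^ (k - i))) := by
  rw [sub_eq_add_neg a b, add_pow, ← sum_add_distrib, mul_sum]
  refine sum_congr rfl fun i hi => ?_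
  rw [fallProd_mul_fallProd hα hk (Nat.lt_succ_iff.1 (mem_range.1 hi)), neg_pow b]
  ring

/-- Upper bound for the expected `k`-th Taylor coefficient in terms of the moment bounds `B`. -/
def coeffBound (α : ℝ) (B : ℕ → ℝ) (k : ℕ) : ℝ :=
  (α - 1) * α ^ (k - 1) * ((if Even k then 4 else 3) * B k +
    ∑ i ∈ range (k + 1), (k.choose i : ℝ) * |leibnizDefect α k i| * B k)

/-- Right-hand side of the Rényi moment bound, as a function of the moment bounds `B`. -/
def renyiMomentBound (α q : ℝ) (m : ℕ) (B : ℕ → ℝ) (K : ℝ) : ℝ :=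
  1 + q ^ 2 * (α * (α - 1)) * K +
    ∑ j ∈ Icc 3 (m - 1), q ^ j / (j.factorial : ℝ) * coeffBound α B j +
    q ^ m / (m.factorial : ℝ) * ∑ i ∈ range (m + 1),
      remWeight α q m i * remTerm α q m i (fun r s => B (r + s))

namespace MomentBounds

variable {Ω : Type*} [MeasurableSpace Ω] {P : Measure Ω} {x y : Ω → ℝ} {B : ℕ → ℝ} {K : ℝ}

lemma integrable_pow_mul_pow (h : MomentBounds P x y B K) (r s : ℕ) :
    Integrable (fun ω => (x ω - 1) ^ r * (y ω - 1) ^ s) P := by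
  have hx := h.measurable_left
  have hy := h.measurable_right
  refine Integrable.mono' ((h.left (r + s)).1.add (h.right (r + s)).1) (by fun_prop)
    (Filter.Eventually.of_forall fun ω => ?_)
  rw [Real.norm_eq_abs, abs_mul, abs_pow, abs_pow]
  simp only [Pi.add_apply]
  have ha := abs_nonneg (x ω - 1)
  have hb := abs_nonneg (y ω - 1)
  rcases le_total |x ω - 1| |y ω - 1| with hab | hab
  · calc _ ≤ |y ω - 1| ^ r * |y ω - 1| ^ s := by gcongr
      _ = |y ω - 1| ^ (r + s) := (pow_add _ _ _).symm
      _ ≤ _ := le_add_of_nonneg_left (by positivity)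
  · calc _ ≤ |x ω - 1| ^ r * |x ω - 1| ^ s := by gcongr
      _ = |x ω - 1| ^ (r + s) := (pow_add _ _ _).symm
      _ ≤ _ := le_add_of_nonneg_right (by positivity)

lemma integrable_abs_pow_mul_abs_pow (h : MomentBounds P x y B K) (r s : ℕ) :
    Integrable (fun ω => |x ω - 1| ^ r * |y ω - 1| ^ s) P := by
  simpa only [abs_mul, abs_pow] using (h.integrable_pow_mul_pow r s).abs

lemma integral_abs_pow_mul_abs_pow_le (h : MomentBounds P x y B K) {r s : ℕ} (hrs : 0 < r + s) :
    ∫ ω, |x ω - 1| ^ r * |y ω - 1| ^ s ∂P ≤ B (r + s) := by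
  have hk : ((r + s : ℕ) : ℝ) ≠ 0 := by positivity
  have hl := h.left (r + s)
  have hr := h.right (r + s)
  calc _ ≤ ∫ ω, ((r : ℝ) / ((r + s : ℕ) : ℝ) * |x ω - 1| ^ (r + s) +
        (s : ℝ) / ((r + s : ℕ) : ℝ) * |y ω - 1| ^ (r + s)) ∂P :=
        integral_mono (h.integrable_abs_pow_mul_abs_pow r s)
          ((hl.1.const_mul _).add (hr.1.const_mul _))
          fun ω => abs_pow_mul_abs_pow_le _ _ hrs
    _ = (r : ℝ) / ((r + s : ℕ) : ℝ) * ∫ ω, |x ω - 1| ^ (r + s) ∂P +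
        (s : ℝ) / ((r + s : ℕ) : ℝ) * ∫ ω, |y ω - 1| ^ (r + s) ∂P := by
        rw [integral_add (hl.1.const_mul _) (hr.1.const_mul _), integral_const_mul,
          integral_const_mul]
    _ ≤ (r : ℝ) / ((r + s : ℕ) : ℝ) * B (r + s) + (s : ℝ) / ((r + s : ℕ) : ℝ) * B (r + s) := by
        gcongr
        · exact hl.2
        · exact hr.2
    _ = B (r + s) := by rw [← add_mul, ← add_div, ← Nat.cast_add, div_self hk, one_mul]

lemma nonneg (h : MomentBounds P x y B K) (k : ℕ) : 0 ≤ B k :=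
  le_trans (integral_nonneg fun _ => by positivity) (h.left k).2

lemma integrable_sub_pow (h : MomentBounds P x y B K) (k : ℕ) :
    Integrable (fun ω => (x ω - y ω) ^ k) P := by
  have : ∀ ω, (x ω - y ω) ^ k = ∑ i ∈ range (k + 1),
      (k.choose i : ℝ) * (-1) ^ (k - i) * ((x ω - 1) ^ i * (y ω - 1) ^ (k - i)) := by
    intro ω
    have hxy : x ω - y ω = (x ω - 1) + -(y ω - 1) := by ring
    rw [hxy, add_pow]
    exact sum_congr rfl fun i _ => by rw [neg_pow (y ω - 1)]; ring
  simp_rw [this]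
  exact integrable_finsetSum _ fun i _ => (h.integrable_pow_mul_pow _ _).const_mul _

lemma integral_sub_pow_le (h : MomentBounds P x y B K) {k : ℕ} (hk : 1 ≤ k) :
    ∫ ω, (x ω - y ω) ^ k ∂P ≤ (if Even k then 4 else 3) * B k := by
  have hB := h.nonneg k
  obtain ⟨i1, h1⟩ := h.left k
  obtain ⟨i2, h2⟩ := h.right k
  obtain ⟨i3, h3⟩ := h.left_right k
  obtain ⟨i4, h4⟩ := h.right_left k
  split_ifs with he
  · calc _ ≤ ∫ ω, ((|x ω - 1| ^ k + |x ω / y ω - 1| ^ k * y ω) +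
          (|y ω - 1| ^ k + |y ω / x ω - 1| ^ k * x ω)) ∂P := by
          refine integral_mono (h.integrable_sub_pow k) ((i1.add i3).add (i2.add i4)) fun ω => ?_
          have hx := h.left_pos ω
          have hy := h.right_pos ω
          have n1 : 0 ≤ |x ω - 1| ^ k + |x ω / y ω - 1| ^ k * y ω := by positivity
          have n2 : 0 ≤ |y ω - 1| ^ k + |y ω / x ω - 1| ^ k * x ω := by positivity
          rcases le_total (y ω) (x ω) with hxy | hxy
          · have := sub_pow_le_of_lt hy hxy hk
            linarith
          · have := sub_pow_le_of_lt hx hxy hk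
            rw [← he.neg_pow, neg_sub] at this
            linarith
      _ = (∫ ω, |x ω - 1| ^ k ∂P + ∫ ω, |x ω / y ω - 1| ^ k * y ω ∂P) +
          (∫ ω, |y ω - 1| ^ k ∂P + ∫ ω, |y ω / x ω - 1| ^ k * x ω ∂P) := by
          rw [← integral_add i1 i3, ← integral_add i2 i4]
          exact integral_add (i1.add i3) (i2.add i4)
      _ ≤ _ := by linarith
  · calc _ ≤ ∫ ω, (|x ω - 1| ^ k + |x ω / y ω - 1| ^ k * y ω) ∂P := by
          refine integral_mono (h.integrable_sub_pow k) (i1.add i3) fun ω => ?_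
          have hy := h.right_pos ω
          rcases le_total (y ω) (x ω) with hxy | hxy
          · exact sub_pow_le_of_lt hy hxy hk
          · exact ((Nat.not_even_iff_odd.1 he).pow_nonpos (sub_nonpos.2 hxy)).trans (by positivity)
      _ = ∫ ω, |x ω - 1| ^ k ∂P + ∫ ω, |x ω / y ω - 1| ^ k * y ω ∂P := integral_add i1 i3
      _ ≤ _ := by linarith

lemma integrable_mixCoeff (h : MomentBounds P x y B K) (α : ℝ) (k : ℕ) :
    Integrable (fun ω => mixCoeff α (x ω - 1) (y ω - 1) k) P :=
  integrable_finsetSum _ fun _ _ => (h.integrable_pow_mul_pow _ _).const_mul _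

lemma integral_mixCoeff_le (h : MomentBounds P x y B K) {α : ℝ} (hα : 1 < α) {k : ℕ}
    (hk : 1 ≤ k) : ∫ ω, mixCoeff α (x ω - 1) (y ω - 1) k ∂P ≤ coeffBound α B k := by
  simp_rw [mixCoeff_eq hα _ _ hk, sub_sub_sub_cancel_right]
  have hi : ∀ i ∈ range (k + 1), Integrable (fun ω => (k.choose i : ℝ) *
      ((-1) ^ (k - i) * leibnizDefect α k i) * ((x ω - 1) ^ i * (y ω - 1) ^ (k - i))) P :=
    fun i _ => (h.integrable_pow_mul_pow _ _).const_mul _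
  rw [integral_const_mul, integral_add (h.integrable_sub_pow k) (integrable_finsetSum _ hi),
    integral_finsetSum _ hi, coeffBound]
  have hα1 : 0 ≤ α - 1 := by linarith
  refine mul_le_mul_of_nonneg_left (add_le_add (h.integral_sub_pow_le hk)
    (sum_le_sum fun i hik => ?_)) (by positivity)
  have hik : i + (k - i) = k := Nat.add_sub_cancel' (Nat.lt_succ_iff.1 (mem_range.1 hik))
  rw [integral_const_mul]
  refine (le_abs_self _).trans ?_
  rw [abs_mul, abs_mul, abs_mul, abs_pow, abs_neg, abs_one, one_pow, one_mul, Nat.abs_cast]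
  refine mul_le_mul_of_nonneg_left ?_ (by positivity)
  refine abs_integral_le_integral_abs.trans ?_
  simp_rw [abs_mul, abs_pow]
  have := h.integral_abs_pow_mul_abs_pow_le (r := i) (s := k - i) (by omega)
  rwa [hik] at this

lemma integral_taylorBound_le [IsProbabilityMeasure P] (h : MomentBounds P x y B K) {α q : ℝ}
    (hα : 1 < α) (hq0 : 0 ≤ q) (hq : q < 1) {m : ℕ} (hm : 3 ≤ m) :
    Integrable (fun ω => taylorBound α q m (x ω - 1) (y ω - 1)) P ∧
    ∫ ω, taylorBound α q m (x ω - 1) (y ω - 1) ∂P ≤ renyiMomentBound α q m B K := by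
  have h1q : 0 < 1 - q := sub_pos.2 hq
  have hc : ∀ j ∈ range m, Integrable (fun ω =>
      q ^ j / (j.factorial : ℝ) * mixCoeff α (x ω - 1) (y ω - 1) j) P :=
    fun j _ => (h.integrable_mixCoeff α j).const_mul _
  have hr : ∀ i ∈ range (m + 1),
      Integrable (fun ω => remTerm α q m i (fun r s => |x ω - 1| ^ r * |y ω - 1| ^ s)) P ∧
      ∫ ω, remTerm α q m i (fun r s => |x ω - 1| ^ r * |y ω - 1| ^ s) ∂P ≤
        remTerm α q m i (fun r s => B (r + s)) := by
    intro i hi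
    have him : i + (m - i) = m := Nat.add_sub_cancel' (Nat.lt_succ_iff.1 (mem_range.1 hi))
    unfold remTerm
    split_ifs with hαi
    · refine ⟨(h.integrable_abs_pow_mul_abs_pow _ _).const_mul _, ?_⟩
      rw [integral_const_mul]
      exact mul_le_mul_of_nonneg_left (h.integral_abs_pow_mul_abs_pow_le (by omega))
        (Real.rpow_nonneg h1q.le _)
    · have hl : ∀ l ∈ range (⌈α⌉₊ - i + 1), Integrable (fun ω =>
          q ^ l * ((⌈α⌉₊ - i).factorial : ℝ) * (m.factorial : ℝ) /
            (((⌈α⌉₊ - i - l).factorial : ℝ) * ((m + l).factorial : ℝ)) *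
            (|x ω - 1| ^ (i + l) * |y ω - 1| ^ (m - i))) P :=
        fun l _ => (h.integrable_abs_pow_mul_abs_pow _ _).const_mul _
      refine ⟨(h.integrable_abs_pow_mul_abs_pow _ _).add (integrable_finsetSum _ hl), ?_⟩
      rw [integral_add (h.integrable_abs_pow_mul_abs_pow _ _) (integrable_finsetSum _ hl),
        integral_finsetSum _ hl]
      refine add_le_add (h.integral_abs_pow_mul_abs_pow_le (by omega)) (sum_le_sum fun l _ => ?_)
      rw [integral_const_mul]
      exact mul_le_mul_of_nonneg_left (h.integral_abs_pow_mul_abs_pow_le (by omega))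
        (by positivity)
  have hs : ∀ i ∈ range (m + 1), Integrable (fun ω => remWeight α q m i *
      remTerm α q m i (fun r s => |x ω - 1| ^ r * |y ω - 1| ^ s)) P :=
    fun i hi => (hr i hi).1.const_mul _
  unfold taylorBound renyiMomentBound
  refine ⟨(integrable_finsetSum _ hc).add ((integrable_finsetSum _ hs).const_mul _), ?_⟩
  rw [integral_add (integrable_finsetSum _ hc) ((integrable_finsetSum _ hs).const_mul _),
    integral_const_mul, integral_finsetSum _ hc, integral_finsetSum _ hs]
  refine add_le_add ?_ (mul_le_mul_of_nonneg_left (sum_le_sum fun i hi => ?_) (by positivity))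
  · have hIcc : Icc 3 (m - 1) = Ico 3 m := by
      ext j
      simp only [mem_Icc, mem_Ico]
      omega
    rw [← sum_range_add_sum_Ico _ hm, hIcc]
    simp_rw [integral_const_mul]
    refine add_le_add ?_ (sum_le_sum fun j hj => ?_)
    · have e0 : ∀ ω, mixCoeff α (x ω - 1) (y ω - 1) 0 = 1 := by
        intro ω
        simp [mixCoeff, fallProd]
      have e1 : ∀ ω, mixCoeff α (x ω - 1) (y ω - 1) 1 =
          α * (x ω - 1) + (1 - α) * (y ω - 1) := by
        intro ω
        simp [mixCoeff, fallProd, sum_range_succ]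
        ring
      have e2 : ∀ ω, mixCoeff α (x ω - 1) (y ω - 1) 2 = α * (α - 1) * (x ω - y ω) ^ 2 := by
        intro ω
        simp [mixCoeff, fallProd, sum_range_succ, prod_range_succ]
        ring
      have ix : Integrable (fun ω => x ω - 1) P := by
        simpa using h.integrable_pow_mul_pow 1 0
      have iy : Integrable (fun ω => y ω - 1) P := by
        simpa using h.integrable_pow_mul_pow 0 1
      rw [sum_range_succ, sum_range_succ, sum_range_succ, range_zero, sum_empty]
      simp_rw [e0, e1, e2]
      rw [integral_add (ix.const_mul _) (iy.const_mul _), integral_const_mul, integral_const_mul,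
        integral_const_mul, h.integral_left, h.integral_right]
      have := mul_le_mul_of_nonneg_left h.integral_sq
        (by have : 0 ≤ α - 1 := by linarith
            positivity : 0 ≤ q ^ 2 * (α * (α - 1)))
      simp
      linarith
    · refine mul_le_mul_of_nonneg_left (h.integral_mixCoeff_le hα ?_) (by positivity)
      have := (mem_Ico.1 hj).1
      omega
  · rw [integral_const_mul]
    exact mul_le_mul_of_nonneg_left (hr i hi).2 (remWeight_nonneg hα hq m i)

end MomentBounds

lemma integrable_withDensity_ofReal_iff {Ω : Type*} [MeasurableSpace Ω] {vol : Measure Ω}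
    {w : Ω → ℝ} (hw : Measurable w) (hw0 : ∀ x, 0 ≤ w x) (h : Ω → ℝ) :
    Integrable h (vol.withDensity fun x => ENNReal.ofReal (w x)) ↔
      Integrable (fun x => h x * w x) vol := by
  rw [integrable_withDensity_iff hw.ennreal_ofReal
    (Filter.Eventually.of_forall fun _ => ENNReal.ofReal_lt_top)]
  simp_rw [ENNReal.toReal_ofReal (hw0 _)]

lemma integral_withDensity_ofReal {Ω : Type*} [MeasurableSpace Ω] {vol : Measure Ω}
    {w : Ω → ℝ} (hw : Measurable w) (hw0 : ∀ x, 0 ≤ w x) (h : Ω → ℝ) :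
    ∫ x, h x ∂(vol.withDensity fun x => ENNReal.ofReal (w x)) = ∫ x, h x * w x ∂vol := by
  rw [integral_withDensity_eq_integral_toReal_smul hw.ennreal_ofReal
    (Filter.Eventually.of_forall fun _ => ENNReal.ofReal_lt_top)]
  simp_rw [ENNReal.toReal_ofReal (hw0 _), smul_eq_mul, mul_comm]

lemma exp_two_mul_add_exp_two_mul_sub_le {a b c v : ℝ} (ha : 0 ≤ a) (hb : 0 ≤ b)
    (hav : a ≤ v) (hbv : b ≤ v) (hcv : c ≤ v) :
    Real.exp (2 * a) + Real.exp (2 * b) - 2 * Real.exp (a + b - c) ≤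
      2 * (Real.exp (2 * v) - Real.exp v) := by
  have hc : Real.exp (a + b - v) ≤ Real.exp (a + b - c) := Real.exp_le_exp.2 (by linarith)
  have e (x : ℝ) : Real.exp (2 * x) = Real.exp x ^ 2 := by
    rw [two_mul, Real.exp_add, sq]
  have hA : 1 ≤ Real.exp a := Real.one_le_exp ha
  have hB : 1 ≤ Real.exp b := Real.one_le_exp hb
  have hAv : Real.exp a ≤ Real.exp v := Real.exp_le_exp.2 hav
  have hBv : Real.exp b ≤ Real.exp v := Real.exp_le_exp.2 hbv
  have hm : Real.exp v * Real.exp (a + b - v) = Real.exp a * Real.exp b := by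
    rw [← Real.exp_add, ← Real.exp_add]
    congr 1
    ring
  rw [e, e, e]
  generalize Real.exp a = A at *
  generalize Real.exp b = B at *
  generalize Real.exp v = W at *
  generalize Real.exp (a + b - v) = Z at *
  have hW : 0 < W := by linarith
  have hZ : W * (A ^ 2 + B ^ 2 - 2 * Z) ≤ W * (2 * (W ^ 2 - W)) := by
    have h1 : W * A ^ 2 + W * B ^ 2 - 2 * (A * B) ≤ 2 * W ^ 3 - 2 * W ^ 2 := by
      have s1 : W * A ^ 2 - 2 * (A * B) ≤ W ^ 3 - 2 * (W * B) := by
        have : 0 ≤ (W - A) * (W * (W + A) - 2 * B) := by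
          refine mul_nonneg (by linarith) ?_
          nlinarith
        nlinarith
      have s2 : W * B ^ 2 - 2 * (W * B) ≤ W ^ 3 - 2 * W ^ 2 := by
        have : 0 ≤ W * ((W - B) * (W + B - 2)) :=
          mul_nonneg hW.le (mul_nonneg (by linarith) (by linarith))
        nlinarith
      linarith
    nlinarith
  have := le_of_mul_le_mul_left hZ hW
  linarith

section GaussianPair

variable {V : Type*} [NormedAddCommGroup V] [InnerProductSpace ℝ V] [MeasurableSpace V]
  [BorelSpace V] {vol : Measure V} [vol.IsAddRightInvariant] {c β v : ℝ} {ν μ₁ μ₂ : V}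

lemma integral_isoDensity_ratio_sub_sq_le (hc : 0 < c) (hβ : 0 ≤ β)
    (h1 : ∫ x, isoDensity c β (0 : V) x ∂vol = 1) (h₁ : β * ‖μ₁ - ν‖ ^ 2 ≤ v)
    (h₂ : β * ‖μ₂ - ν‖ ^ 2 ≤ v) (h₁₂ : β * ‖μ₁ - μ₂‖ ^ 2 ≤ v) :
    ∫ x, (isoDensity c β μ₁ x / isoDensity c β ν x - isoDensity c β μ₂ x / isoDensity c β ν x) ^ 2 *
      isoDensity c β ν x ∂vol ≤ 2 * (Real.exp (2 * v) - Real.exp v) := by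
  have hr₁ := integral_isoDensity_ratio_pow hc h1 μ₁ ν 2
  have hr₂ := integral_isoDensity_ratio_pow hc h1 μ₂ ν 2
  have hr := integral_isoDensity_ratio_pow_mul hc h1 μ₁ μ₂ ν 1 1
  simp only [pow_one, Nat.cast_one, one_smul, one_mul] at hr
  have hsub : ∀ x, (isoDensity c β μ₁ x / isoDensity c β ν x -
      isoDensity c β μ₂ x / isoDensity c β ν x) ^ 2 * isoDensity c β ν x =
      (isoDensity c β μ₁ x / isoDensity c β ν x) ^ 2 * isoDensity c β ν x +
      (isoDensity c β μ₂ x / isoDensity c β ν x) ^ 2 * isoDensity c β ν x -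
      2 * (isoDensity c β μ₁ x / isoDensity c β ν x * (isoDensity c β μ₂ x / isoDensity c β ν x) *
        isoDensity c β ν x) := fun x => by ring
  simp_rw [hsub]
  have hadd : Integrable (fun x => (isoDensity c β μ₁ x / isoDensity c β ν x) ^ 2 *
      isoDensity c β ν x + (isoDensity c β μ₂ x / isoDensity c β ν x) ^ 2 *
      isoDensity c β ν x) vol := hr₁.1.add hr₂.1
  rw [integral_sub hadd (hr.1.const_mul 2), integral_add hr₁.1 hr₂.1,
    integral_const_mul, hr₁.2, hr₂.2, hr.2]
  have hn : ‖μ₁ - ν + (μ₂ - ν)‖ ^ 2 =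
      2 * ‖μ₁ - ν‖ ^ 2 + 2 * ‖μ₂ - ν‖ ^ 2 - ‖μ₁ - μ₂‖ ^ 2 := by
    have := parallelogram_law_with_norm ℝ (μ₁ - ν) (μ₂ - ν)
    rw [sub_sub_sub_cancel_right] at this
    linarith
  refine le_trans (le_of_eq ?_) (exp_two_mul_add_exp_two_mul_sub_le (a := β * ‖μ₁ - ν‖ ^ 2)
    (b := β * ‖μ₂ - ν‖ ^ 2) (by positivity) (by positivity) h₁ h₂ h₁₂)
  have h2 (t : ℝ) : t * (((2 : ℕ) : ℝ) * (((2 : ℕ) : ℝ) - 1)) = 2 * t := by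
    push_cast
    ring
  rw [hn, h2, h2]
  congr 3
  ring

lemma momentBounds_isoDensity (hc : 0 < c) (hβ : 0 ≤ β)
    (h1 : ∫ x, isoDensity c β (0 : V) x ∂vol = 1) (h₁ : β * ‖μ₁ - ν‖ ^ 2 ≤ v)
    (h₂ : β * ‖μ₂ - ν‖ ^ 2 ≤ v) (h₁₂ : β * ‖μ₁ - μ₂‖ ^ 2 ≤ v) :
    MomentBounds (vol.withDensity fun x => ENNReal.ofReal (isoDensity c β ν x))
      (fun x => isoDensity c β μ₁ x / isoDensity c β ν x)
      (fun x => isoDensity c β μ₂ x / isoDensity c β ν x)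
      (fun k => absGaussMoment k v) (Real.exp (2 * v) - Real.exp v) := by
  have hm (μ : V) : Measurable (isoDensity c β μ) := (continuous_isoDensity c β μ).measurable
  have hp (μ x : V) : 0 < isoDensity c β μ x := isoDensity_pos hc β μ x
  have h21 : β * ‖μ₂ - μ₁‖ ^ 2 ≤ v := by rwa [norm_sub_rev]
  have hsub (μ : V) : ∫ x, (isoDensity c β μ x / isoDensity c β ν x - 1) * isoDensity c β ν x ∂vol
      = 0 := by
    have h := integral_isoDensity_ratio_sub_one_pow hc h1 μ ν 1
    simpa [gaussMoment, sum_range_succ] using h.2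
  have habs (μ : V) (h : β * ‖μ - ν‖ ^ 2 ≤ v) (k : ℕ) :=
    integral_abs_isoDensity_ratio_sub_one_pow_le hc hβ h1 μ ν h k
  have hcross (μ μ' : V) (h : β * ‖μ - μ'‖ ^ 2 ≤ v) (k : ℕ) :
      Integrable (fun x => |isoDensity c β μ x / isoDensity c β ν x /
        (isoDensity c β μ' x / isoDensity c β ν x) - 1| ^ k *
        (isoDensity c β μ' x / isoDensity c β ν x) * isoDensity c β ν x) vol ∧
      ∫ x, |isoDensity c β μ x / isoDensity c β ν x /
        (isoDensity c β μ' x / isoDensity c β ν x) - 1| ^ k *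
        (isoDensity c β μ' x / isoDensity c β ν x) * isoDensity c β ν x ∂vol ≤
        absGaussMoment k v := by
    simp_rw [div_div_div_cancel_right₀ (hp ν _).ne', mul_assoc, div_mul_cancel₀ _ (hp ν _).ne']
    exact integral_abs_isoDensity_ratio_sub_one_pow_le hc hβ h1 μ μ' h k
  constructor
  · exact (hm μ₁).div (hm ν)
  · exact (hm μ₂).div (hm ν)
  · exact fun x => div_pos (hp _ _) (hp _ _)
  · exact fun x => div_pos (hp _ _) (hp _ _)
  all_goals simp_rw [integral_withDensity_ofReal (hm ν) fun x => (hp ν x).le]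
  · exact hsub μ₁
  · exact hsub μ₂
  · exact integral_isoDensity_ratio_sub_sq_le hc hβ h1 h₁ h₂ h₁₂
  all_goals simp_rw [integrable_withDensity_ofReal_iff (hm ν) fun x => (hp ν x).le]
  · exact habs μ₁ h₁
  · exact habs μ₂ h₂
  · exact hcross μ₁ μ₂ h₁₂
  · exact hcross μ₂ μ₁ h21

lemma integral_mixture_isoDensity_le (hc : 0 < c) (hβ : 0 ≤ β)
    (h1 : ∫ x, isoDensity c β (0 : V) x ∂vol = 1) (h₁ : β * ‖μ₁ - ν‖ ^ 2 ≤ v)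
    (h₂ : β * ‖μ₂ - ν‖ ^ 2 ≤ v) (h₁₂ : β * ‖μ₁ - μ₂‖ ^ 2 ≤ v) {α q : ℝ}
    (hα : 1 < α) (hq0 : 0 ≤ q) (hq : q < 1) {m : ℕ} (hm : 3 ≤ m) :
    Integrable (fun x =>
      ((q * isoDensity c β μ₁ x + (1 - q) * isoDensity c β ν x) /
        (q * isoDensity c β μ₂ x + (1 - q) * isoDensity c β ν x)) ^ α *
        (q * isoDensity c β μ₂ x + (1 - q) * isoDensity c β ν x)) vol ∧
    ∫ x, ((q * isoDensity c β μ₁ x + (1 - q) * isoDensity c β ν x) /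
        (q * isoDensity c β μ₂ x + (1 - q) * isoDensity c β ν x)) ^ α *
        (q * isoDensity c β μ₂ x + (1 - q) * isoDensity c β ν x) ∂vol ≤
      renyiMomentBound α q m (fun k => absGaussMoment k v) (Real.exp (2 * v) - Real.exp v) := by
  have hm' (μ : V) : Measurable (isoDensity c β μ) := (continuous_isoDensity c β μ).measurable
  have hp (μ x : V) : 0 < isoDensity c β μ x := isoDensity_pos hc β μ x
  have hν := integral_isoDensity h1 ν
  have hP : IsProbabilityMeasure
      (vol.withDensity fun x => ENNReal.ofReal (isoDensity c β ν x)) := by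
    refine ⟨?_⟩
    rw [withDensity_apply _ MeasurableSet.univ, setLIntegral_univ,
      ← ofReal_integral_eq_lintegral_ofReal hν.1
      (Filter.Eventually.of_forall fun x => (hp ν x).le), hν.2, ENNReal.ofReal_one]
  have hT := (momentBounds_isoDensity hc hβ h1 h₁ h₂ h₁₂).integral_taylorBound_le hα hq0 hq hm
  rw [integrable_withDensity_ofReal_iff (hm' ν) fun x => (hp ν x).le,
    integral_withDensity_ofReal (hm' ν) fun x => (hp ν x).le] at hT
  have h1q : 0 < 1 - q := sub_pos.2 hq
  have hmix (μ x : V) : 0 < q * isoDensity c β μ x + (1 - q) * isoDensity c β ν x :=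
    add_pos_of_nonneg_of_pos (mul_nonneg hq0 (hp _ _).le) (mul_pos h1q (hp _ _))
  have hle (x : V) : ((q * isoDensity c β μ₁ x + (1 - q) * isoDensity c β ν x) /
        (q * isoDensity c β μ₂ x + (1 - q) * isoDensity c β ν x)) ^ α *
        (q * isoDensity c β μ₂ x + (1 - q) * isoDensity c β ν x) ≤
      taylorBound α q m (isoDensity c β μ₁ x / isoDensity c β ν x - 1)
        (isoDensity c β μ₂ x / isoDensity c β ν x - 1) * isoDensity c β ν x := by
    have hfac (μ : V) : q * isoDensity c β μ x + (1 - q) * isoDensity c β ν x =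
        (1 + q * (isoDensity c β μ x / isoDensity c β ν x - 1)) * isoDensity c β ν x := by
      have := (hp ν x).ne'
      field_simp
      ring
    have hpos (μ : V) : 0 < 1 + q * (isoDensity c β μ x / isoDensity c β ν x - 1) :=
      pos_of_mul_pos_left ((hfac μ).symm ▸ hmix μ x) (hp ν x).le
    have hge (μ : V) : -1 ≤ isoDensity c β μ x / isoDensity c β ν x - 1 := by
      have := div_pos (hp μ x) (hp ν x)
      linarith
    rw [hfac, hfac, mul_div_mul_right _ _ (hp ν x).ne', ← mul_assoc]
    refine mul_le_mul_of_nonneg_right (le_trans (le_of_eq ?_)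
      (rpow_mul_rpow_le_taylorBound hα hq0 hq (hge μ₁) (hge μ₂) m)) (hp ν x).le
    rw [Real.div_rpow (hpos μ₁).le (hpos μ₂).le, Real.rpow_sub (hpos μ₂), Real.rpow_one]
    ring
  have hnn (x : V) : 0 ≤ ((q * isoDensity c β μ₁ x + (1 - q) * isoDensity c β ν x) /
        (q * isoDensity c β μ₂ x + (1 - q) * isoDensity c β ν x)) ^ α *
        (q * isoDensity c β μ₂ x + (1 - q) * isoDensity c β ν x) :=
    mul_nonneg (Real.rpow_nonneg (div_pos (hmix _ _) (hmix _ _)).le _) (hmix _ _).le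
  have hmeas : Measurable (fun x =>
      ((q * isoDensity c β μ₁ x + (1 - q) * isoDensity c β ν x) /
        (q * isoDensity c β μ₂ x + (1 - q) * isoDensity c β ν x)) ^ α *
        (q * isoDensity c β μ₂ x + (1 - q) * isoDensity c β ν x)) := by
    have := hm' μ₁
    have := hm' μ₂
    have := hm' ν
    fun_prop
  have hint := hT.1.mono' hmeas.aestronglyMeasurable (Filter.Eventually.of_forall fun x => by
    rw [Real.norm_of_nonneg (hnn x)]
    exact hle x)
  exact ⟨hint, (integral_mono hint hT.1 hle).trans hT.2⟩

end GaussianPair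

lemma integral_isoDensity_zero_eq_one {V : Type*} [NormedAddCommGroup V] [InnerProductSpace ℝ V]
    [FiniteDimensional ℝ V] [MeasurableSpace V] [BorelSpace V] {s : ℝ} (hs : s ≠ 0) :
    ∫ x, isoDensity ((2 * Real.pi * s ^ 2) ^ (-(Module.finrank ℝ V : ℝ) / 2)) (2 * s ^ 2)⁻¹
      (0 : V) x = 1 := by
  have hs2 : 0 < 2 * s ^ 2 := by positivity
  have hπ : 0 < 2 * Real.pi * s ^ 2 := by positivity
  simp only [isoDensity, sub_zero]
  rw [integral_const_mul, GaussianFourier.integral_rexp_neg_mul_sq_norm (inv_pos.2 hs2),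
    div_inv_eq_mul, show Real.pi * (2 * s ^ 2) = 2 * Real.pi * s ^ 2 by ring,
    ← Real.rpow_add hπ, neg_div, neg_add_cancel, Real.rpow_zero]

lemma gaussND_eq_isoDensity {p : ℕ} (μ : EuclideanSpace ℝ (Fin p)) (s : ℝ) :
    gaussND μ s = isoDensity ((2 * Real.pi * s ^ 2) ^ (-(p : ℝ) / 2)) (2 * s ^ 2)⁻¹ μ := by
  funext x
  rw [gaussND, isoDensity]
  congr 2
  ring

lemma gauss1_eq_isoDensity (μ s : ℝ) :
    gauss1 μ s = isoDensity ((2 * Real.pi * s ^ 2) ^ (-(1 : ℝ) / 2)) (2 * s ^ 2)⁻¹ μ := by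
  funext x
  rw [gauss1, isoDensity, Real.norm_eq_abs, sq_abs]
  congr 2
  ring

lemma Mcoef_eq_gaussMoment {σ : ℝ} (hσ : 0 < σ) (k : ℕ) :
    Mcoef σ k = gaussMoment k (2 / σ ^ 2) := by
  have h1 := integral_isoDensity_zero_eq_one (V := ℝ) (s := σ / 2) (by positivity)
  rw [Module.finrank_self, Nat.cast_one] at h1
  have h := (integral_isoDensity_ratio_sub_one_pow (by positivity) h1 1 0 k).2
  rw [Mcoef, gauss1_eq_isoDensity, gauss1_eq_isoDensity, h]
  congr 1
  rw [sub_zero, norm_one]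
  field_simp

lemma Btil_eq_absGaussMoment {σ : ℝ} (hσ : 0 < σ) (k : ℕ) :
    Btil σ k = absGaussMoment k (2 / σ ^ 2) := by
  simp only [Btil, absGaussMoment, Mcoef_eq_gaussMoment hσ]

lemma Ftil_eq_coeffBound (α σ : ℝ) (k : ℕ) : Ftil α σ k = coeffBound α (Btil σ) k := by
  rw [Ftil, coeffBound, mul_add]
  congr 2
  rw [Btil]
  split_ifs <;> rfl

lemma Etil_eq_sum (α σ : ℝ) (m : ℕ) (q : ℝ) :
    Etil α σ m q = q ^ m / (m.factorial : ℝ) * ∑ i ∈ range (m + 1),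
      remWeight α q m i * remTerm α q m i (fun r s => Btil σ (r + s)) := by
  rw [Etil]
  congr 1
  refine sum_congr rfl fun i hi => ?_
  have him : i + (m - i) = m := Nat.add_sub_cancel' (Nat.lt_succ_iff.1 (mem_range.1 hi))
  have hl (l : ℕ) : i + l + (m - i) = l + m := by omega
  simp only [remWeight, remTerm, him, hl]

lemma absGaussMoment_nonneg (k : ℕ) {v : ℝ} (hv : 0 ≤ v) : 0 ≤ absGaussMoment k v := by
  unfold absGaussMoment
  split_ifs with hk
  · rcases Nat.eq_zero_or_pos k with rfl | hk
    · simp [gaussMoment]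
    · exact gaussMoment_nonneg hk hv
  · exact Real.sqrt_nonneg _

lemma one_le_renyiMomentBound {α q : ℝ} (hα : 1 < α) (hq0 : 0 ≤ q) (hq : q < 1) (m : ℕ)
    {B : ℕ → ℝ} (hB : ∀ k, 0 ≤ B k) {K : ℝ} (hK : 0 ≤ K) : 1 ≤ renyiMomentBound α q m B K := by
  have hα1 : 0 ≤ α - 1 := by linarith
  have h1q : 0 ≤ 1 - q := by linarith
  have hc (j : ℕ) : 0 ≤ coeffBound α B j := by
    have := hB j
    unfold coeffBound
    split_ifs <;> positivity
  have hr (i : ℕ) : 0 ≤ remTerm α q m i (fun r s => B (r + s)) := by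
    unfold remTerm
    split_ifs
    · exact mul_nonneg (Real.rpow_nonneg h1q _) (hB _)
    · exact add_nonneg (hB _) (sum_nonneg fun l _ => mul_nonneg (by positivity) (hB _))
  have h2 : 0 ≤ q ^ 2 * (α * (α - 1)) * K := by positivity
  have h3 : 0 ≤ ∑ j ∈ Icc 3 (m - 1), q ^ j / (j.factorial : ℝ) * coeffBound α B j :=
    sum_nonneg fun j _ => mul_nonneg (by positivity) (hc j)
  have h4 : 0 ≤ q ^ m / (m.factorial : ℝ) * ∑ i ∈ range (m + 1),
      remWeight α q m i * remTerm α q m i (fun r s => B (r + s)) :=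
    mul_nonneg (by positivity)
      (sum_nonneg fun i _ => mul_nonneg (remWeight_nonneg hα hq m i) (hr i))
  unfold renyiMomentBound
  linarith

lemma rpow_div_mul_sum_le {ι : Type*} (T : Finset ι) {w P Q : ι → ℝ} (hw : ∀ t ∈ T, 0 ≤ w t)
    (hP : ∀ t ∈ T, 0 ≤ P t) (hQ : ∀ t ∈ T, 0 < Q t) (hQ' : 0 < ∑ t ∈ T, w t * Q t)
    {α : ℝ} (hα : 1 ≤ α) :
    ((∑ t ∈ T, w t * P t) / ∑ t ∈ T, w t * Q t) ^ α * ∑ t ∈ T, w t * Q t ≤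
      ∑ t ∈ T, w t * ((P t / Q t) ^ α * Q t) := by
  have h := Real.rpow_arith_mean_le_arith_mean_rpow T
    (fun t => w t * Q t / ∑ t ∈ T, w t * Q t) (fun t => P t / Q t)
    (fun t ht => div_nonneg (mul_nonneg (hw t ht) (hQ t ht).le) hQ'.le)
    (by rw [← sum_div, div_self hQ'.ne'])
    (fun t ht => div_nonneg (hP t ht) (hQ t ht).le) hα
  have e1 : ∑ t ∈ T, w t * Q t / (∑ t ∈ T, w t * Q t) * (P t / Q t) =
      (∑ t ∈ T, w t * P t) / ∑ t ∈ T, w t * Q t := by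
    rw [sum_div]
    refine sum_congr rfl fun t ht => ?_
    have := (hQ t ht).ne'
    field_simp
  rw [e1] at h
  refine (mul_le_mul_of_nonneg_right h hQ'.le).trans (le_of_eq ?_)
  rw [sum_mul]
  refine sum_congr rfl fun t _ => ?_
  field_simp

section Coupling

variable {ι : Type*} [DecidableEq ι]

lemma sum_powersetCard_succ_sum_erase (S : Finset ι) (k : ℕ) (h : Finset ι → ℝ) :
    ∑ t ∈ (powersetCard (k + 1) S).sigma (fun B => B), h (t.1.erase t.2) =
      ((S.card - k : ℕ) : ℝ) * ∑ A ∈ powersetCard k S, h A := by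
  have hr : ((S.card - k : ℕ) : ℝ) * ∑ A ∈ powersetCard k S, h A =
      ∑ t ∈ (powersetCard k S).sigma (fun A => S \ A), h t.1 := by
    rw [sum_sigma, mul_sum]
    refine sum_congr rfl fun A hA => ?_
    obtain ⟨hAS, hAk⟩ := mem_powersetCard.1 hA
    simp [sum_const, card_sdiff_of_subset hAS, hAk]
  rw [hr]
  refine sum_bij' (fun t _ => ⟨t.1.erase t.2, t.2⟩) (fun t _ => ⟨insert t.2 t.1, t.2⟩)
    ?_ ?_ ?_ ?_ fun _ _ => rfl
  · rintro ⟨B, j⟩ ht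
    simp only [mem_sigma, mem_powersetCard, mem_sdiff, mem_erase] at ht ⊢
    exact ⟨⟨(erase_subset _ _).trans ht.1.1, by rw [card_erase_of_mem ht.2, ht.1.2]; rfl⟩,
      ht.1.1 ht.2, by simp⟩
  · rintro ⟨A, j⟩ ht
    simp only [mem_sigma, mem_powersetCard, mem_sdiff] at ht ⊢
    exact ⟨⟨insert_subset ht.2.1 ht.1.1, by rw [card_insert_of_notMem ht.2.2, ht.1.2]⟩,
      mem_insert_self _ _⟩
  · rintro ⟨B, j⟩ ht
    simp only [mem_sigma] at ht
    simp [insert_erase ht.2]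
  · rintro ⟨A, j⟩ ht
    simp only [mem_sigma, mem_sdiff] at ht
    simp [erase_insert ht.2.2]

/-- The uniform average over `k`-subsets of `insert i S` is an average over pairs `(B, j)`, with
`B` a `k`-subset of `S` and `j ∈ B`, of two-point mixtures of `B` and `B` with `j` replaced
by `i`. -/
lemma sum_powersetCard_insert_eq {S : Finset ι} {i : ι} (hi : i ∉ S) {n k : ℕ}
    (hn : S.card + 1 = n) (hk : 1 ≤ k) (hkn : k < n) (f : Finset ι → ℝ) :
    (n.choose k : ℝ)⁻¹ * ∑ b ∈ powersetCard k (insert i S), f b =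
      ∑ t ∈ (powersetCard k S).sigma (fun B => B), ((k : ℝ) * (S.card.choose k : ℝ))⁻¹ *
        ((k : ℝ) / n * f (insert i (t.1.erase t.2)) + (1 - (k : ℝ) / n) * f t.1) := by
  obtain ⟨k, rfl⟩ := Nat.exists_eq_add_of_le' hk
  have hsplit : ∑ b ∈ powersetCard (k + 1) (insert i S), f b =
      ∑ B ∈ powersetCard (k + 1) S, f B + ∑ A ∈ powersetCard k S, f (insert i A) := by
    rw [powersetCard_succ_insert hi, sum_union, sum_image]
    · intro A hA A' hA' h
      have hA := fun h => hi ((mem_powersetCard.1 hA).1 h)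
      have hA' := fun h => hi ((mem_powersetCard.1 hA').1 h)
      rw [← erase_insert hA, ← erase_insert hA', h]
    · rw [disjoint_left]
      intro B hB hB'
      obtain ⟨A, -, rfl⟩ := mem_image.1 hB'
      exact hi ((mem_powersetCard.1 hB).1 (mem_insert_self _ _))
  have hB : ∑ t ∈ (powersetCard (k + 1) S).sigma (fun B => B), f t.1 =
      ((k + 1 : ℕ) : ℝ) * ∑ B ∈ powersetCard (k + 1) S, f B := by
    rw [sum_sigma, mul_sum]
    refine sum_congr rfl fun B hB => ?_
    simp [sum_const, (mem_powersetCard.1 hB).2]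
  have hA := sum_powersetCard_succ_sum_erase S k fun A => f (insert i A)
  rw [← mul_sum, sum_add_distrib, ← mul_sum, ← mul_sum, hA, hB, hsplit]
  subst hn
  have hch := Nat.choose_mul_succ_eq S.card (k + 1)
  have hc0 : ((S.card.choose (k + 1) : ℕ) : ℝ) ≠ 0 := by
    exact_mod_cast (Nat.choose_pos (by omega)).ne'
  have hc1 : (((S.card + 1).choose (k + 1) : ℕ) : ℝ) ≠ 0 := by
    exact_mod_cast (Nat.choose_pos (by omega)).ne'
  obtain ⟨d, hd⟩ := Nat.exists_eq_add_of_le (show k + 1 ≤ S.card by omega)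
  have e1 : S.card - k = d + 1 := by omega
  have e2 : S.card + 1 - (k + 1) = d + 1 := by omega
  rw [e2] at hch
  have hch' : ((S.card.choose (k + 1) : ℕ) : ℝ) * ((S.card + 1 : ℕ) : ℝ) =
      (((S.card + 1).choose (k + 1) : ℕ) : ℝ) * ((d + 1 : ℕ) : ℝ) := by exact_mod_cast hch
  have hn : ((S.card + 1 : ℕ) : ℝ) = ((k + 1 : ℕ) : ℝ) + ((d + 1 : ℕ) : ℝ) := by
    rw [hd]
    push_cast
    ring
  have hk0 : ((k + 1 : ℕ) : ℝ) ≠ 0 := by positivity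
  have hd0 : ((d + 1 : ℕ) : ℝ) ≠ 0 := by positivity
  have hn0 : ((S.card + 1 : ℕ) : ℝ) ≠ 0 := by positivity
  have hw : (((k + 1 : ℕ) : ℝ) * (S.card.choose (k + 1) : ℝ))⁻¹ *
      (((k + 1 : ℕ) : ℝ) / ((S.card + 1 : ℕ) : ℝ) * ((d + 1 : ℕ) : ℝ)) =
      (((S.card + 1).choose (k + 1) : ℕ) : ℝ)⁻¹ := by
    field_simp
    rw [hch']
    ring
  have hq : (1 - ((k + 1 : ℕ) : ℝ) / ((S.card + 1 : ℕ) : ℝ)) * ((k + 1 : ℕ) : ℝ) =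
      ((k + 1 : ℕ) : ℝ) / ((S.card + 1 : ℕ) : ℝ) * ((d + 1 : ℕ) : ℝ) := by
    rw [one_sub_div hn0, hn]
    ring
  rw [e1, ← mul_assoc (_ / _), ← mul_assoc (1 - _), hq, ← mul_add, ← mul_assoc, hw,
    add_comm (∑ B ∈ _, _)]

end Coupling

lemma norm_clip_le {E : Type*} [NormedAddCommGroup E] [NormedSpace ℝ E] {C : ℝ} (hC : 0 < C)
    (x : E) : ‖clip C x‖ ≤ C := by
  have h1 : 0 < max 1 (‖x‖ / C) := lt_max_of_lt_left one_pos
  rw [clip, norm_smul, norm_inv, Real.norm_of_nonneg h1.le, inv_mul_le_iff₀ h1]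
  exact (div_le_iff₀ hC).1 (le_max_right _ _)

lemma inv_mul_norm_sub_sq_le {E : Type*} [NormedAddCommGroup E] [NormedSpace ℝ E] {C r σ : ℝ}
    (hC : 0 < C) (hr : 0 < r) (hσ : 0 < σ) (a : E) {u u' : E} (hu : ‖u‖ ≤ C) (hu' : ‖u'‖ ≤ C) :
    (2 * (C * r * σ) ^ 2)⁻¹ * ‖(a - r • u) - (a - r • u')‖ ^ 2 ≤ 2 / σ ^ 2 := by
  have h : ‖(a - r • u) - (a - r • u')‖ ≤ 2 * (C * r) := by
    rw [sub_sub_sub_cancel_left, ← smul_sub, norm_smul, Real.norm_of_nonneg hr.le]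
    have := mul_le_mul_of_nonneg_left ((norm_sub_le u' u).trans (add_le_add hu' hu)) hr.le
    linarith
  calc _ ≤ (2 * (C * r * σ) ^ 2)⁻¹ * (2 * (C * r)) ^ 2 := by gcongr
    _ = 2 / σ ^ 2 := by
      field_simp

lemma muStep_insert {X : Type*} {p n : ℕ} (C η : ℝ) (k : ℕ)
    (g : EuclideanSpace ℝ (Fin p) → X → EuclideanSpace ℝ (Fin p))
    (θ : EuclideanSpace ℝ (Fin p)) {A : Finset (Fin n)} {i : Fin n} (hi : i ∉ A) (D : Fin n → X) :
    muStep C η k g θ (insert i A) D =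
      muStep C η k g θ A D - (η / (k : ℝ)) • clip C (g θ (D i)) := by
  rw [muStep, muStep, sum_insert hi, smul_add]
  abel

lemma muStep_congr {X : Type*} {p n : ℕ} (C η : ℝ) (k : ℕ)
    (g : EuclideanSpace ℝ (Fin p) → X → EuclideanSpace ℝ (Fin p))
    (θ : EuclideanSpace ℝ (Fin p)) {A : Finset (Fin n)} {D D' : Fin n → X}
    (h : ∀ j ∈ A, D j = D' j) : muStep C η k g θ A D = muStep C η k g θ A D' := by
  rw [muStep, muStep, sum_congr rfl fun j hj => by rw [h j hj]]

lemma integral_rpow_pFSwoR_le {X : Type*} {p : ℕ} {C η σ : ℝ} (hC : 0 < C) (hη : 0 < η)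
    (hσ : 0 < σ) {k n : ℕ} (hk : 1 ≤ k) (hkn : k < n)
    (g : EuclideanSpace ℝ (Fin p) → X → EuclideanSpace ℝ (Fin p)) {D D' : Fin n → X}
    (hadj : AdjReplaceOne D D') {α : ℝ} (hα : 1 < α) {m : ℕ} (hm : 3 ≤ m)
    (θ : EuclideanSpace ℝ (Fin p)) :
    ∫ x, (pFSwoR C η σ k g n D θ x / pFSwoR C η σ k g n D' θ x) ^ α *
        pFSwoR C η σ k g n D' θ x ≤
      renyiMomentBound α ((k : ℝ) / n) m (fun j => absGaussMoment j (2 / σ ^ 2))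
        (Real.exp (2 * (2 / σ ^ 2)) - Real.exp (2 / σ ^ 2)) := by
  obtain ⟨i, -, hD⟩ := hadj
  have hk0 : (0 : ℝ) < k := by exact_mod_cast hk
  have hn0 : (0 : ℝ) < n := by exact_mod_cast hk.trans hkn.le
  have hq0 : 0 ≤ (k : ℝ) / n := by positivity
  have hq : (k : ℝ) / n < 1 := (div_lt_one hn0).2 (by exact_mod_cast hkn)
  have h1q : 0 < 1 - (k : ℝ) / n := sub_pos.2 hq
  have hr : 0 < η / k := div_pos hη hk0
  set s := C * η * σ / (k : ℝ) with hs
  have hs' : s = C * (η / k) * σ := by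
    rw [hs]
    ring
  have hs0 : 0 < s := by positivity
  set c := (2 * Real.pi * s ^ 2) ^ (-(p : ℝ) / 2) with hcdef
  have hc : 0 < c := by positivity
  have hβ : 0 ≤ (2 * s ^ 2)⁻¹ := by positivity
  have h1 : ∫ x, isoDensity c (2 * s ^ 2)⁻¹ (0 : EuclideanSpace ℝ (Fin p)) x = 1 := by
    have := integral_isoDensity_zero_eq_one (V := EuclideanSpace ℝ (Fin p)) hs0.ne'
    rwa [finrank_euclideanSpace_fin] at this
  set S := (univ : Finset (Fin n)).erase i with hSdef
  have hi : i ∉ S := notMem_erase i univ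
  have hS : insert i S = univ := insert_erase (mem_univ i)
  have hcard : S.card + 1 = n := by
    rw [← card_insert_of_notMem hi, hS, card_univ, Fintype.card_fin]
  set T := (powersetCard k S).sigma (fun B => B) with hT
  set w := ((k : ℝ) * (S.card.choose k : ℝ))⁻¹ with hw
  have hw0 : 0 < w := by
    have : 0 < S.card.choose k := Nat.choose_pos (by omega)
    positivity
  have hwT : ∑ _t ∈ T, w = 1 := by
    have h := sum_powersetCard_insert_eq hi hcard hk hkn fun _ => (1 : ℝ)
    simp only [sum_const, card_powersetCard, card_insert_of_notMem hi, hcard, nsmul_eq_mul,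
      mul_one, add_sub_cancel] at h
    rw [sum_const, nsmul_eq_mul, ← h]
    exact inv_mul_cancel₀ (by exact_mod_cast (Nat.choose_pos hkn.le).ne')
  have hT' : T.Nonempty := by
    rw [nonempty_iff_ne_empty]
    rintro h
    simp [h] at hwT
  let M (E : Fin n → X) (b : Finset (Fin n)) := isoDensity c (2 * s ^ 2)⁻¹ (muStep C η k g θ b E)
  let R (E : Fin n → X) (t : (_ : Finset (Fin n)) × Fin n) (x : EuclideanSpace ℝ (Fin p)) :=
    (k : ℝ) / n * M E (insert i (t.1.erase t.2)) x + (1 - (k : ℝ) / n) * M E t.1 x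
  have hp (E : Fin n → X) (x) : pFSwoR C η σ k g n E θ x = ∑ t ∈ T, w * R E t x := by
    rw [← sum_powersetCard_insert_eq hi hcard hk hkn fun b => M E b x, hS]
    simp only [pFSwoR, gaussND_eq_isoDensity]
    rfl
  have hM (E b x) : 0 < M E b x := isoDensity_pos hc _ _ x
  have hR (E t x) : 0 < R E t x :=
    add_pos_of_nonneg_of_pos (mul_nonneg hq0 (hM _ _ x).le) (mul_pos h1q (hM _ _ x))
  have hsum (E x) : 0 < ∑ t ∈ T, w * R E t x := sum_pos (fun t _ => mul_pos hw0 (hR E t x)) hT'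
  have hbound : ∀ t ∈ T, Integrable (fun x => (R D t x / R D' t x) ^ α * R D' t x) ∧
      ∫ x, (R D t x / R D' t x) ^ α * R D' t x ≤
        renyiMomentBound α ((k : ℝ) / n) m (fun j => absGaussMoment j (2 / σ ^ 2))
          (Real.exp (2 * (2 / σ ^ 2)) - Real.exp (2 / σ ^ 2)) := by
    rintro ⟨B, j⟩ ht
    obtain ⟨hB, hj⟩ := mem_sigma.1 ht
    dsimp only at hB hj
    have hiB : i ∉ B := fun h => hi ((mem_powersetCard.1 hB).1 h)
    have hiA : i ∉ B.erase j := fun h => hiB (mem_of_mem_erase h)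
    have hBD : ∀ l ∈ B, D l = D' l := fun l hl => hD l fun h => hiB (h ▸ hl)
    have e₀ : muStep C η k g θ B D = muStep C η k g θ (B.erase j) D -
        (η / (k : ℝ)) • clip C (g θ (D j)) := by
      rw [← muStep_insert C η k g θ (notMem_erase j B), insert_erase hj]
    have e₁ := muStep_insert C η k g θ hiA D
    have e₂ := muStep_insert C η k g θ hiA D'
    rw [← muStep_congr C η k g θ fun l hl => hBD l (mem_of_mem_erase hl)] at e₂
    have hdist (y z : X) := inv_mul_norm_sub_sq_le hC hr hσ (muStep C η k g θ (B.erase j) D)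
      (norm_clip_le hC (g θ y)) (norm_clip_le hC (g θ z))
    rw [← hs'] at hdist
    have h := integral_mixture_isoDensity_le (μ₁ := muStep C η k g θ (insert i (B.erase j)) D)
      (μ₂ := muStep C η k g θ (insert i (B.erase j)) D') (ν := muStep C η k g θ B D)
      (v := 2 / σ ^ 2) hc hβ h1 (by rw [e₀, e₁]; exact hdist _ _)
      (by rw [e₀, e₂]; exact hdist _ _) (by rw [e₁, e₂]; exact hdist _ _) hα hq0 hq hm
    simp only [R, M]
    rwa [← muStep_congr C η k g θ hBD]
  simp_rw [hp]
  calc _ ≤ ∫ x, ∑ t ∈ T, w * ((R D t x / R D' t x) ^ α * R D' t x) := by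
        refine integral_mono_of_nonneg (Filter.Eventually.of_forall fun x => ?_)
          (integrable_finsetSum _ fun t ht => (hbound t ht).1.const_mul _)
          (Filter.Eventually.of_forall fun x => ?_)
        · exact mul_nonneg (Real.rpow_nonneg (div_pos (hsum D x) (hsum D' x)).le _) (hsum D' x).le
        · exact rpow_div_mul_sum_le T (fun _ _ => hw0.le) (fun t _ => (hR D t x).le)
            (fun t _ => hR D' t x) (hsum D' x) hα.le
    _ = ∑ t ∈ T, w * ∫ x, (R D t x / R D' t x) ^ α * R D' t x := by
        rw [integral_finsetSum _ fun t ht => (hbound t ht).1.const_mul _]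
        simp_rw [integral_const_mul]
    _ ≤ ∑ t ∈ T, w * renyiMomentBound α ((k : ℝ) / n) m (fun j => absGaussMoment j (2 / σ ^ 2))
          (Real.exp (2 * (2 / σ ^ 2)) - Real.exp (2 / σ ^ 2)) :=
        sum_le_sum fun t ht => mul_le_mul_of_nonneg_left (hbound t ht).2 hw0.le
    _ = _ := by rw [← sum_mul, hwT, one_mul]

/-- one-step FSwoR-RDP upper bound, replace-one adjacency. -/
theorem stmt3 {X : Type*} {pd : ℕ} (hpd : 1 ≤ pd)
    (C η σ : ℝ) (hC : 0 < C) (hη : 0 < η) (hσ : 0 < σ)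
    (k n : ℕ) (hk : 1 ≤ k) (hkn : k ≤ n)
    (g : EuclideanSpace ℝ (Fin pd) → X → EuclideanSpace ℝ (Fin pd))
    (D D' : Fin n → X) (hadj : AdjReplaceOne D D')
    (hq : (k : ℝ) / n < 1)
    (α : ℝ) (hα : 1 < α) (m : ℕ) (hm : 3 ≤ m) :
    ∀ θ : EuclideanSpace ℝ (Fin pd),
      renyiDiv volume α (pFSwoR C η σ k g n D θ) (pFSwoR C η σ k g n D' θ) ≤
        (α - 1)⁻¹ *
          Real.log (1 + ((k : ℝ) / n) ^ 2 * (α * (α - 1)) *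
              (Real.exp (4 / σ ^ 2) - Real.exp (2 / σ ^ 2)) +
            (∑ j ∈ Finset.Icc 3 (m - 1), ((k : ℝ) / n) ^ j / (j.factorial : ℝ) * Ftil α σ j) +
            Etil α σ m ((k : ℝ) / n)) := by
  intro θ
  have hn0 : (0 : ℝ) < n := by exact_mod_cast hk.trans hkn
  have hkn' : k < n := by exact_mod_cast (div_lt_one hn0).1 hq
  have hv : 0 ≤ 2 / σ ^ 2 := by positivity
  have hI := integral_rpow_pFSwoR_le hC hη hσ hk hkn' g hadj hα hm θ
  have hR := one_le_renyiMomentBound hα (by positivity : 0 ≤ (k : ℝ) / n) hq m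
    (fun j => absGaussMoment_nonneg j hv) (K := Real.exp (2 * (2 / σ ^ 2)) - Real.exp (2 / σ ^ 2))
    (sub_nonneg.2 (Real.exp_le_exp.2 (by linarith)))
  have hI0 : 0 ≤ ∫ x, (pFSwoR C η σ k g n D θ x / pFSwoR C η σ k g n D' θ x) ^ α *
      pFSwoR C η σ k g n D' θ x := by
    have h (E : Fin n → X) (x) : 0 ≤ pFSwoR C η σ k g n E θ x := by
      unfold pFSwoR gaussND
      positivity
    exact integral_nonneg fun x => mul_nonneg (Real.rpow_nonneg (div_nonneg (h D x) (h D' x)) _)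
      (h D' x)
  have hB : Btil σ = fun j => absGaussMoment j (2 / σ ^ 2) :=
    funext fun j => Btil_eq_absGaussMoment hσ j
  have h4 : 4 / σ ^ 2 = 2 * (2 / σ ^ 2) := by ring
  simp only [Ftil_eq_coeffBound, Etil_eq_sum, hB, h4]
  refine mul_le_mul_of_nonneg_left ?_ (inv_nonneg.2 (by linarith))
  rcases hI0.eq_or_lt with h | h
  · rw [← h, Real.log_zero]
    exact Real.log_nonneg hR
  · exact Real.log_le_log h hI
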